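/- arXiv:2508.20509 — 2 statements merged into one kernel-verified Lean document; each statement's English description precedes it below -/
import Mathlib

section
/- Let q be a power of an odd prime and let n, d, s be integers with 1 ≤ d < n−1 and 0 ≤ 2s ≤ d, and set e = 2(n−d)s. Then the number of irreducible characters of R_u^{D,d} of degree q^e equals q^{2d(n−d)−2e+s²−s} · ∏_{i=0}^{2s−1} (q^{d−i}−1) / ∏_{i=1}^{s} (q^{2i}−1). Moreover, the set of integers that occur as degrees of irreducible characters of R_u^{D,d} is precisely { q^{2(n−d)s} : 0 ≤ 2s ≤ d }. -/
open Matrix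

namespace SOUnipotentRadical

/-- The index type for `n×n` matrices, split as `d + (n−d)`. -/
abbrev ι (n d : ℕ) := Fin d ⊕ Fin (n - d)

/-- The index type for `2n×2n` matrices, split as `n + n`. -/
abbrev κ (n d : ℕ) := ι n d ⊕ ι n d

/-- `U(A) = [[I_d, A],[0, I_{n−d}]]`. -/
def Umat (F : Type) [Field F] (n d : ℕ) (A : Matrix (Fin d) (Fin (n - d)) F) :
    Matrix (ι n d) (ι n d) F :=
  Matrix.fromBlocks 1 A 0 1

/-- `K_d`: skew-symmetric `n×n` matrices whose lower-right `(n−d)×(n−d)` block is zero. -/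
def Kd (F : Type) [Field F] (n d : ℕ) : Set (Matrix (ι n d) (ι n d) F) :=
  {V | Vᵀ = -V ∧ ∀ i j, V (Sum.inr i) (Sum.inr j) = 0}

/-- `R_u^{D,d} = { [[U(A), V·U(A)⁻ᵀ],[0, U(A)⁻ᵀ]] | A ∈ Mat_{d×(n−d)}, V ∈ K_d }`. -/
def RuD (F : Type) [Field F] (n d : ℕ) : Set (Matrix (κ n d) (κ n d) F) :=
  {g | ∃ (A : Matrix (Fin d) (Fin (n - d)) F) (V : Matrix (ι n d) (ι n d) F),
    V ∈ Kd F n d ∧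
    g = Matrix.fromBlocks (Umat F n d A) (V * ((Umat F n d A)ᵀ)⁻¹) 0 ((Umat F n d A)ᵀ)⁻¹}

end SOUnipotentRadical

namespace FDRep

open CategoryTheory

variable {G : Type} [Group G]

theorem exists_smul_one_of_commute (V : FDRep ℂ G) [Simple V] (T : V →ₗ[ℂ] V)
    (hT : ∀ h, T * V.ρ h = V.ρ h * T) : ∃ c : ℂ, T = c • (1 : V →ₗ[ℂ] V) := by
  let f : V ⟶ V := ⟨InducedCategory.homMk (ModuleCat.ofHom T), fun h => by
    ext x
    exact LinearMap.congr_fun (hT h) x⟩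
  obtain ⟨c, hc⟩ := (finrank_eq_one_iff_of_nonzero' (𝟙 V) (id_nonzero V)).mp
    (finrank_endomorphism_simple_eq_one ℂ V) f
  refine ⟨c, ?_⟩
  have : f.hom.hom.hom = (c • 𝟙 V : V ⟶ V).hom.hom.hom := by rw [hc]
  exact this

theorem finrank_pos_of_simple (V : FDRep ℂ G) [Simple V] : 0 < Module.finrank ℂ V := by
  rw [Module.finrank_pos_iff]
  by_contra h
  rw [not_nontrivial_iff_subsingleton] at h
  apply id_nonzero V
  ext x
  exact Subsingleton.elim _ _

/-- If `R` acts by scalars on a nonzero representation, it acts by the same scalars on some simple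
representation. -/
theorem exists_simple_of_scalar (R : Set G) (η : G → ℂ)
    (h : ∃ V : FDRep ℂ G, 0 < Module.finrank ℂ V ∧ ∀ r ∈ R, V.ρ r = η r • (1 : V →ₗ[ℂ] V)) :
    ∃ V : FDRep ℂ G, Simple V ∧ ∀ r ∈ R, V.ρ r = η r • (1 : V →ₗ[ℂ] V) := by
  classical
  have hex : ∃ n, ∃ V : FDRep ℂ G, (0 < Module.finrank ℂ V ∧
      ∀ r ∈ R, V.ρ r = η r • (1 : V →ₗ[ℂ] V)) ∧ Module.finrank ℂ V = n := by
    obtain ⟨V, hV⟩ := h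
    exact ⟨_, V, hV, rfl⟩
  obtain ⟨V, ⟨hpos, hV⟩, hn⟩ := Nat.find_spec hex
  refine ⟨V, ⟨fun {Y} f hf => ⟨fun hi h0 => ?_, fun h0 => ?_⟩⟩, hV⟩
  · subst h0
    have hz : 𝟙 V = 0 := by
      rw [← IsIso.inv_hom_id (0 : Y ⟶ V)]; simp
    rw [Module.finrank_pos_iff] at hpos
    obtain ⟨x, hx⟩ := exists_ne (0 : V)
    apply hx
    have : (𝟙 V : V ⟶ V).hom.hom.hom x = (0 : V ⟶ V).hom.hom.hom x := by rw [hz]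
    exact this
  · have hinj : Function.Injective f.hom.hom.hom := by
      have : Mono ((forget₂ (FDRep ℂ G) (Rep ℂ G)).map f) := inferInstance
      exact (Rep.mono_iff_injective _).mp this
    have hcomm : ∀ g (y : Y), f.hom.hom.hom (Y.ρ g y) = V.ρ g (f.hom.hom.hom y) := fun g y =>
      ConcreteCategory.congr_hom ((forget (FGModuleCat ℂ)).congr_map (f.comm g)) y
    have hYpos : 0 < Module.finrank ℂ Y := by
      rw [Module.finrank_pos_iff]
      by_contra hs
      rw [not_nontrivial_iff_subsingleton] at hs
      apply h0
      ext x
      rw [Subsingleton.elim x 0]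
      exact (map_zero f.hom.hom.hom)
    have hY : ∀ r ∈ R, Y.ρ r = η r • (1 : Y →ₗ[ℂ] Y) := by
      intro r hr
      ext y
      apply hinj
      rw [hcomm, hV r hr]
      simp
    have hle : Module.finrank ℂ V ≤ Module.finrank ℂ Y := by
      rw [hn]
      exact Nat.find_min' hex ⟨Y, ⟨hYpos, hY⟩, rfl⟩
    have heq : Module.finrank ℂ Y = Module.finrank ℂ V :=
      le_antisymm (LinearMap.finrank_le_finrank_of_injective hinj) hle
    have : Epi f := by
      have : Epi ((forget₂ (FDRep ℂ G) (Rep ℂ G)).map f) := by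
        rw [Rep.epi_iff_surjective]
        exact (LinearMap.injective_iff_surjective_of_finrank_eq_finrank heq).mp hinj
      exact (forget₂ (FDRep ℂ G) (Rep ℂ G)).epi_of_epi_map this
    exact isIso_of_mono_of_epi f

/-- Functions on `G` transforming on the left under `R` by `η`. -/
def equivariantFunctions (R : Subgroup G) (η : G → ℂ) : Submodule ℂ (G → ℂ) where
  carrier := {f | ∀ r ∈ R, ∀ g, f (r * g) = η r * f g}
  add_mem' := fun {a b} ha hb r hr g => by
    simp only [Pi.add_apply, ha r hr g, hb r hr g, mul_add]
  zero_mem' := fun r hr g => by simp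
  smul_mem' := fun c f hf r hr g => by
    simp only [Pi.smul_apply, hf r hr g, smul_eq_mul]; ring

/-- Right translation on `equivariantFunctions`. -/
def equivariantFunctionsRep (R : Subgroup G) (η : G → ℂ) :
    Representation ℂ G (equivariantFunctions R η) where
  toFun h :=
    { toFun := fun f => ⟨fun g => f.1 (g * h), fun r hr g => by
        simpa only [mul_assoc] using f.2 r hr (g * h)⟩
      map_add' := fun _ _ => rfl
      map_smul' := fun _ _ => rfl }
  map_one' := by ext f g; simp
  map_mul' := fun a b => by ext f g; simp [mul_assoc]

theorem exists_simple_lying_over [Finite G] (R : Subgroup G) (hR : R.Normal) (η : G → ℂ)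
    (h1 : η 1 = 1) (hmul : ∀ r ∈ R, ∀ s ∈ R, η (r * s) = η r * η s)
    (hconj : ∀ r ∈ R, ∀ g, η (g * r * g⁻¹) = η r) :
    ∃ V : FDRep ℂ G, Simple V ∧ ∀ r ∈ R, V.ρ r = η r • (1 : V →ₗ[ℂ] V) := by
  classical
  apply exists_simple_of_scalar (R : Set G)
  refine ⟨FDRep.of (equivariantFunctionsRep R η), ?_, fun r hr => ?_⟩
  · change 0 < Module.finrank ℂ (equivariantFunctions R η)
    rw [Module.finrank_pos_iff_exists_ne_zero]
    refine ⟨⟨fun g => if g ∈ R then η g else 0, fun r hr g => ?_⟩, fun h0 => ?_⟩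
    · by_cases hg : g ∈ R
      · simp [hg, R.mul_mem_cancel_left hr, hmul r hr g hg]
      · simp [hg, R.mul_mem_cancel_left hr]
    · have := congrFun (congrArg Subtype.val h0) 1
      simp [R.one_mem, h1] at this
  · change equivariantFunctionsRep R η r = η r • (1 : equivariantFunctions R η →ₗ[ℂ] _)
    ext f g
    change f.1 (g * r) = η r * f.1 g
    rw [← hconj r hr g, ← f.2 _ (hR.conj_mem r hr g)]
    simp

/-- The scalar by which `g` acts on `V`, when it does act by a scalar. -/
noncomputable def scalar (V : FDRep ℂ G) (g : G) : ℂ := V.character g / V.character 1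

theorem character_one_ne_zero (V : FDRep ℂ G) [Simple V] : V.character 1 ≠ 0 := by
  rw [char_one]
  exact_mod_cast (finrank_pos_of_simple V).ne'

theorem scalar_eq {V : FDRep ℂ G} [Simple V] {g : G} {c : ℂ}
    (h : V.ρ g = c • (1 : V →ₗ[ℂ] V)) : scalar V g = c := by
  have : V.character g = c * V.character 1 := by
    simp [character, h]
  rw [scalar, this, mul_div_cancel_right₀ _ (character_one_ne_zero V)]

theorem rho_eq_scalar {V : FDRep ℂ G} [Simple V] {g : G}
    (h : ∀ x, V.ρ (g * x) = V.ρ (x * g)) : V.ρ g = scalar V g • (1 : V →ₗ[ℂ] V) := by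
  obtain ⟨c, hc⟩ := exists_smul_one_of_commute V (V.ρ g) (fun x => by
    rw [← map_mul, ← map_mul, h])
  rw [scalar_eq hc, hc]

theorem scalar_mul {V : FDRep ℂ G} [Simple V] {g h : G}
    (hg : V.ρ g = scalar V g • (1 : V →ₗ[ℂ] V)) (hh : V.ρ h = scalar V h • (1 : V →ₗ[ℂ] V)) :
    scalar V (g * h) = scalar V g * scalar V h := by
  apply scalar_eq
  rw [map_mul, hg, hh, smul_mul_smul_comm, one_mul]

theorem scalar_one {V : FDRep ℂ G} [Simple V] : scalar V 1 = 1 :=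
  div_self (character_one_ne_zero V)

theorem finrank_sq_eq_index [Finite G] (V : FDRep ℂ G) [Simple V] (R : Subgroup G)
    (hR : ∀ r ∈ R, V.ρ r = scalar V r • (1 : V →ₗ[ℂ] V)) (h0 : ∀ g ∉ R, V.character g = 0) :
    Module.finrank ℂ V ^ 2 = R.index := by
  classical
  have := Fintype.ofFinite G
  have h := (simple_iff_char_is_norm_one V).mp inferInstance
  have hs : ∀ g : G, V.character g * V.character g⁻¹ =
      if g ∈ R then (V.character 1) ^ 2 else 0 := by
    intro g
    split_ifs with hg
    · have hm := scalar_mul (hR g hg) (hR _ (R.inv_mem hg))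
      rw [mul_inv_cancel, scalar_one, scalar, scalar] at hm
      have := character_one_ne_zero V
      field_simp at hm
      exact hm.symm
    · rw [h0 g hg, zero_mul]
  simp_rw [hs] at h
  rw [← Finset.sum_filter, Finset.sum_const, char_one] at h
  have hc : (Finset.univ.filter (· ∈ R)).card = Nat.card R := by
    rw [← Fintype.card_subtype, Nat.card_eq_fintype_card]
  rw [hc, nsmul_eq_mul, ← R.card_mul_index] at h
  have : Nat.card R * Module.finrank ℂ V ^ 2 = Nat.card R * R.index := by exact_mod_cast h
  exact Nat.eq_of_mul_eq_mul_left Nat.card_pos this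

end FDRep

namespace SOUnipotentRadical

/-- The left radical of the commutator form of `β` paired with the character `l`. -/
def charRadical {W Z : Type} [AddCommGroup W] [AddCommGroup Z] (β : W →+ W →+ Z)
    (l : AddChar Z ℂ) : AddSubgroup W where
  carrier := {w | ∀ x, l (β w x) = l (β x w)}
  add_mem' := fun {a b} ha hb x => by
    simp only [map_add, AddMonoidHom.add_apply, AddChar.map_add_eq_mul, ha x, hb x]
  zero_mem' := fun x => by simp
  neg_mem' := fun {a} ha x => by
    simp only [map_neg, AddMonoidHom.neg_apply, AddChar.map_neg_eq_inv, ha x]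

section ClassTwo

variable {G W Z : Type} [Group G] [AddCommGroup W] [AddCommGroup Z] (β : W →+ W →+ Z)
  (φ : G ≃ W × Z)

open Classical in
/-- The character of the extension of `W` by `Z` with cocycle `β` lying over `l` and `θ`. -/
noncomputable def classTwoChar (l : AddChar Z ℂ) (θ : AddChar (charRadical β l) ℂ) (g : G) : ℂ :=
  if h : (φ g).1 ∈ charRadical β l then
    (Nat.sqrt (charRadical β l).index : ℂ) * (l (φ g).2 * θ ⟨(φ g).1, h⟩) else 0

variable (hφ : ∀ g h, φ (g * h) =
  ((φ g).1 + (φ h).1, (φ g).2 + (φ h).2 + β (φ g).1 (φ h).1))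

include hφ

theorem coord_one : φ 1 = 0 := by
  have h := hφ 1 1
  rw [mul_one] at h
  have h1 : (φ 1).1 = 0 := by simpa using congrArg Prod.fst h
  have h2 : (φ 1).2 = 0 := by simpa [h1] using congrArg Prod.snd h
  exact Prod.ext h1 h2

/-- The projection of the extension onto its quotient `W`. -/
def projW : G →* Multiplicative W where
  toFun g := Multiplicative.ofAdd (φ g).1
  map_one' := by rw [coord_one β φ hφ]; rfl
  map_mul' := fun g h => by rw [hφ]; rfl

/-- The preimage of the radical of `l` in the extension. -/
def radicalSubgroup (l : AddChar Z ℂ) : Subgroup G :=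
  (AddSubgroup.toSubgroup (charRadical β l)).comap (projW β φ hφ)

theorem mem_radicalSubgroup (l : AddChar Z ℂ) (g : G) :
    g ∈ radicalSubgroup β φ hφ l ↔ (φ g).1 ∈ charRadical β l := Iff.rfl

theorem index_radicalSubgroup (l : AddChar Z ℂ) :
    (radicalSubgroup β φ hφ l).index = (charRadical β l).index := by
  rw [radicalSubgroup, Subgroup.index_comap_of_surjective, AddSubgroup.index_toSubgroup]
  intro w
  exact ⟨φ.symm (w.toAdd, 0), by simp [projW]⟩

theorem symm_mul_symm (w w' : W) (z z' : Z) :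
    φ.symm (w, z) * φ.symm (w', z') = φ.symm (w + w', z + z' + β w w') := by
  apply φ.injective
  rw [hφ]
  simp

theorem mul_swap (g h : G) :
    g * h = φ.symm (0, β (φ g).1 (φ h).1 - β (φ h).1 (φ g).1) * (h * g) := by
  apply φ.injective
  rw [hφ, hφ, hφ]
  ext <;> simp <;> abel

theorem eq_center_mul (g : G) : g = φ.symm (0, (φ g).2) * φ.symm ((φ g).1, 0) := by
  rw [symm_mul_symm β φ hφ]
  simp

theorem center_comm (z : Z) (g : G) : φ.symm (0, z) * g = g * φ.symm (0, z) := by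
  apply φ.injective
  rw [hφ, hφ]
  ext <;> simp [add_comm]

theorem radicalSubgroup_normal (l : AddChar Z ℂ) : (radicalSubgroup β φ hφ l).Normal :=
  Subgroup.Normal.comap (by constructor; intro n hn g; simpa [mul_comm g n] using hn) _

theorem classTwoChar_one (l : AddChar Z ℂ) (θ : AddChar (charRadical β l) ℂ) :
    classTwoChar β φ l θ 1 = (Nat.sqrt (charRadical β l).index : ℂ) := by
  have hm : (φ 1).1 ∈ charRadical β l := by rw [coord_one β φ hφ]; exact zero_mem _
  rw [classTwoChar, dif_pos hm]
  have h2 : (⟨(φ 1).1, hm⟩ : charRadical β l) = 0 := by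
    ext; simp [coord_one β φ hφ]
  rw [h2]
  simp [coord_one β φ hφ]

theorem classTwoChar_injective [Finite W] : Function.Injective
    (fun x : (Σ l : AddChar Z ℂ, AddChar (charRadical β l) ℂ) => classTwoChar β φ x.1 x.2) := by
  rintro ⟨l, θ⟩ ⟨l', θ'⟩ h
  replace h : classTwoChar β φ l θ = classTwoChar β φ l' θ' := h
  have hval : ∀ l (θ : AddChar (charRadical β l) ℂ) w (hw : w ∈ charRadical β l) z,
      classTwoChar β φ l θ (φ.symm (w, z)) / classTwoChar β φ l θ 1 = l z * θ ⟨w, hw⟩ := by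
    intro l θ w hw z
    have hne : (Nat.sqrt (charRadical β l).index : ℂ) ≠ 0 := by
      have := AddSubgroup.index_ne_zero_of_finite (H := charRadical β l)
      exact_mod_cast (Nat.sqrt_pos.mpr (Nat.pos_of_ne_zero this)).ne'
    rw [classTwoChar_one β φ hφ, classTwoChar, dif_pos (by simpa using hw),
      mul_div_cancel_left₀ _ hne]
    simp
  have hll : l = l' := by
    ext z
    have a := hval l θ 0 (zero_mem _) z
    rw [h, hval l' θ' 0 (zero_mem _) z] at a
    have e1 : (⟨0, zero_mem _⟩ : charRadical β l) = 0 := rfl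
    have e2 : (⟨0, zero_mem _⟩ : charRadical β l') = 0 := rfl
    simpa [e1, e2] using a.symm
  subst hll
  congr 1
  ext ⟨w, hw⟩
  have a := hval l θ w hw 0
  rw [h, hval l θ' w hw 0] at a
  simpa using a.symm

variable [Finite G]

/-- Each simple representation has a character of the form `classTwoChar`. -/
theorem exists_classTwoChar_eq
    (hβ : ∀ l : AddChar Z ℂ, ∀ w ∈ charRadical β l, ∀ w' ∈ charRadical β l, l (β w w') = 1)
    (V : FDRep ℂ G) [CategoryTheory.Simple V] :
    ∃ l θ, V.character = classTwoChar β φ l θ := by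
  have hZ : ∀ z, V.ρ (φ.symm (0, z)) = V.scalar (φ.symm (0, z)) • (1 : V →ₗ[ℂ] V) := fun z =>
    FDRep.rho_eq_scalar fun x => by rw [center_comm β φ hφ]
  have h1 : φ.symm (0, 0) = 1 := by
    rw [Equiv.symm_apply_eq, coord_one β φ hφ]; rfl
  let l : AddChar Z ℂ :=
    { toFun := fun z => V.scalar (φ.symm (0, z))
      map_zero_eq_one' := by rw [h1, FDRep.scalar_one]
      map_add_eq_mul' := fun a b => by
        rw [← FDRep.scalar_mul (hZ a) (hZ b), symm_mul_symm β φ hφ]; simp }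
  have hl : ∀ z, V.ρ (φ.symm (0, z)) = l z • (1 : V →ₗ[ℂ] V) := hZ
  have hswap : ∀ g h, V.ρ (g * h) =
      l (β (φ g).1 (φ h).1 - β (φ h).1 (φ g).1) • V.ρ (h * g) := fun g h => by
    conv_lhs => rw [mul_swap β φ hφ g h, map_mul, hl, smul_mul_assoc, one_mul]
  have hR : ∀ g ∈ radicalSubgroup β φ hφ l, V.ρ g = V.scalar g • (1 : V →ₗ[ℂ] V) := by
    intro g hg
    apply FDRep.rho_eq_scalar
    intro x
    rw [hswap, AddChar.map_sub_eq_div, (mem_radicalSubgroup β φ hφ l g).mp hg,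
      div_self (l.val_isUnit _).ne_zero, one_smul]
  have h0 : ∀ g ∉ radicalSubgroup β φ hφ l, V.character g = 0 := by
    intro g hg
    have : ∃ x, l (β (φ g).1 x) ≠ l (β x (φ g).1) := by
      by_contra hc
      push Not at hc
      exact hg hc
    obtain ⟨x, hx⟩ := this
    set h := φ.symm (x, 0)
    have hhx : (φ h).1 = x := by simp [h]
    have e : V.character g = l (β (φ g).1 x - β x (φ g).1) * V.character g := by
      conv_lhs => rw [show g = (g * h) * h⁻¹ by group]
      rw [FDRep.character, map_mul, hswap, hhx, smul_mul_assoc, ← map_mul, map_smul,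
        smul_eq_mul]
      congr 1
      exact FDRep.char_conj V g h
    rw [AddChar.map_sub_eq_div] at e
    have hne : l (β (φ g).1 x) / l (β x (φ g).1) ≠ 1 := fun he =>
      hx ((div_eq_one_iff_eq (l.val_isUnit _).ne_zero).mp he)
    by_contra hc
    exact hne (mul_right_cancel₀ hc (by rw [one_mul]; exact e.symm))
  have hW : ∀ w ∈ charRadical β l, V.ρ (φ.symm (w, 0)) =
      V.scalar (φ.symm (w, 0)) • (1 : V →ₗ[ℂ] V) := fun w hw =>
    hR _ (by rw [mem_radicalSubgroup]; simpa using hw)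
  let θ : AddChar (charRadical β l) ℂ :=
    { toFun := fun w => V.scalar (φ.symm (w.1, 0))
      map_zero_eq_one' := by
        change V.scalar (φ.symm (0, 0)) = 1
        rw [h1, FDRep.scalar_one]
      map_add_eq_mul' := fun a b => by
        rw [← FDRep.scalar_mul (hW a a.2) (hW b b.2), symm_mul_symm β φ hφ]
        have : φ.symm (a.1 + b.1, 0 + 0 + β a.1 b.1) =
            φ.symm (0, β a.1 b.1) * φ.symm (a.1 + b.1, 0) := by
          rw [symm_mul_symm β φ hφ]; simp
        rw [this, FDRep.scalar_mul (hZ _) (hW _ (add_mem a.2 b.2))]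
        have : V.scalar (φ.symm (0, β a.1 b.1)) = 1 := hβ l a a.2 b b.2
        rw [this, one_mul]; rfl }
  refine ⟨l, θ, ?_⟩
  ext g
  have hdim := FDRep.finrank_sq_eq_index V _ hR h0
  rw [index_radicalSubgroup] at hdim
  rw [classTwoChar]
  split_ifs with hg
  · have hs : V.scalar g = l (φ g).2 * θ ⟨(φ g).1, hg⟩ := by
      conv_lhs => rw [eq_center_mul β φ hφ g, FDRep.scalar_mul (hZ _) (hW _ hg)]
      rfl
    rw [← hs, ← hdim, Nat.sqrt_eq', ← FDRep.char_one, FDRep.scalar,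
      mul_div_cancel₀ _ (FDRep.character_one_ne_zero V)]
  · exact h0 g hg

/-- Each `classTwoChar` is the character of a simple representation. -/
theorem exists_simple_character_eq
    (hβ : ∀ l : AddChar Z ℂ, ∀ w ∈ charRadical β l, ∀ w' ∈ charRadical β l, l (β w w') = 1)
    (l : AddChar Z ℂ) (θ : AddChar (charRadical β l) ℂ) :
    ∃ V : FDRep ℂ G, CategoryTheory.Simple V ∧ V.character = classTwoChar β φ l θ := by
  classical
  let η : G → ℂ := fun g => if h : (φ g).1 ∈ charRadical β l then
    l (φ g).2 * θ ⟨(φ g).1, h⟩ else 0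
  have hη : ∀ g (h : (φ g).1 ∈ charRadical β l), η g = l (φ g).2 * θ ⟨(φ g).1, h⟩ :=
    fun g h => dif_pos h
  have hη0 : ∀ w (hw : w ∈ charRadical β l) z, η (φ.symm (w, z)) = l z * θ ⟨w, hw⟩ := by
    intro w hw z
    rw [hη _ (by simpa using hw)]
    simp
  have hmul : ∀ r ∈ radicalSubgroup β φ hφ l, ∀ s ∈ radicalSubgroup β φ hφ l,
      η (r * s) = η r * η s := by
    intro r hr s hs
    rw [hη r hr, hη s hs, hη (r * s) (mul_mem hr hs)]
    have e : (⟨(φ (r * s)).1, mul_mem hr hs⟩ : charRadical β l) =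
        ⟨(φ r).1, hr⟩ + ⟨(φ s).1, hs⟩ := by
      ext; simp [hφ]
    rw [e, hφ]
    have hb : l (β (φ r).1 (φ s).1) = 1 := hβ l _ hr _ hs
    simp only [AddChar.map_add_eq_mul, hb]
    ring
  have hone : η 1 = 1 := by
    have : (1 : G) = φ.symm (0, 0) := by
      symm; rw [Equiv.symm_apply_eq, coord_one β φ hφ]; rfl
    rw [this, hη0 0 (zero_mem _)]
    have : (⟨0, zero_mem _⟩ : charRadical β l) = 0 := rfl
    simp [this]
  have hN := radicalSubgroup_normal β φ hφ l
  obtain ⟨V, hV, hact⟩ := FDRep.exists_simple_lying_over (radicalSubgroup β φ hφ l)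
    hN η hone hmul (by
      intro r hr g
      have : g * r * g⁻¹ = φ.symm (0, β (φ g).1 (φ r).1 - β (φ r).1 (φ g).1) * r := by
        rw [mul_swap β φ hφ g r]; group
      rw [this, hmul _ (by rw [mem_radicalSubgroup]; simp [zero_mem]) _ hr, hη0 0 (zero_mem _)]
      have : (⟨0, zero_mem _⟩ : charRadical β l) = 0 := rfl
      rw [this, AddChar.map_sub_eq_div, (mem_radicalSubgroup β φ hφ l r).mp hr,
        div_self (l.val_isUnit _).ne_zero]
      simp)
  refine ⟨V, hV, ?_⟩
  obtain ⟨l', θ', h'⟩ := exists_classTwoChar_eq β φ hφ hβ V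
  have hsc : ∀ r ∈ radicalSubgroup β φ hφ l, V.scalar r = η r := fun r hr =>
    FDRep.scalar_eq (hact r hr)
  have hne := FDRep.character_one_ne_zero V
  have hone' : V.character 1 = (Nat.sqrt (charRadical β l').index : ℂ) := by
    rw [h', classTwoChar_one β φ hφ]
  have hval : ∀ w (hw : w ∈ charRadical β l') z, V.scalar (φ.symm (w, z)) = l' z * θ' ⟨w, hw⟩ := by
    intro w hw z
    rw [FDRep.scalar, hone', h', classTwoChar, dif_pos (by simpa using hw)]
    rw [hone'] at hne
    rw [mul_div_cancel_left₀ _ hne]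
    simp
  have hll : l = l' := by
    ext z
    have a := hval 0 (zero_mem _) z
    rw [hsc _ (by rw [mem_radicalSubgroup]; simp [zero_mem]), hη0 0 (zero_mem _)] at a
    have e1 : (⟨0, zero_mem _⟩ : charRadical β l) = 0 := rfl
    have e2 : (⟨0, zero_mem _⟩ : charRadical β l') = 0 := rfl
    simpa [e1, e2] using a
  subst hll
  have hθ : θ = θ' := by
    ext ⟨w, hw⟩
    have a := hval w hw 0
    rw [hsc _ (by rw [mem_radicalSubgroup]; simpa using hw), hη0 w hw] at a
    simpa using a
  rw [hθ, h']

theorem exists_simple_iff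
    (hβ : ∀ l : AddChar Z ℂ, ∀ w ∈ charRadical β l, ∀ w' ∈ charRadical β l, l (β w w') = 1)
    (χ : G → ℂ) : (∃ V : FDRep ℂ G, CategoryTheory.Simple V ∧ V.character = χ) ↔
      ∃ l θ, classTwoChar β φ l θ = χ := by
  constructor
  · rintro ⟨V, hV, rfl⟩
    obtain ⟨l, θ, h⟩ := exists_classTwoChar_eq β φ hφ hβ V
    exact ⟨l, θ, h.symm⟩
  · rintro ⟨l, θ, rfl⟩
    exact exists_simple_character_eq β φ hφ hβ l θ

/-- The number of irreducible characters of degree `D`. -/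
theorem card_irreducible_characters [Finite W] [Finite Z]
    (hβ : ∀ l : AddChar Z ℂ, ∀ w ∈ charRadical β l, ∀ w' ∈ charRadical β l, l (β w w') = 1)
    (D N : ℕ) (hN : ∀ l : AddChar Z ℂ, Nat.sqrt (charRadical β l).index = D →
      Nat.card (charRadical β l) = N) :
    Nat.card {χ : G → ℂ | (∃ V : FDRep ℂ G, CategoryTheory.Simple V ∧ V.character = χ) ∧
      χ 1 = (D : ℂ)} =
      Nat.card {l : AddChar Z ℂ // Nat.sqrt (charRadical β l).index = D} * N := by
  classical
  let f : (Σ l : {l : AddChar Z ℂ // Nat.sqrt (charRadical β l).index = D},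
      AddChar (charRadical β l.1) ℂ) → {χ : G → ℂ |
      (∃ V : FDRep ℂ G, CategoryTheory.Simple V ∧ V.character = χ) ∧ χ 1 = (D : ℂ)} := fun x =>
    ⟨classTwoChar β φ x.1.1 x.2, (exists_simple_iff β φ hφ hβ _).mpr ⟨_, _, rfl⟩, by
      rw [classTwoChar_one β φ hφ, x.1.2]⟩
  have hf : Function.Bijective f := by
    constructor
    · rintro ⟨⟨l, hl⟩, θ⟩ ⟨⟨l', hl'⟩, θ'⟩ h
      have := @classTwoChar_injective _ _ _ _ _ _ β φ hφ _ ⟨l, θ⟩ ⟨l', θ'⟩ (congrArg Subtype.val h)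
      cases this
      rfl
    · rintro ⟨χ, hχ, h1⟩
      obtain ⟨l, θ, rfl⟩ := (exists_simple_iff β φ hφ hβ _).mp hχ
      rw [classTwoChar_one β φ hφ] at h1
      exact ⟨⟨⟨l, by exact_mod_cast h1⟩, θ⟩, rfl⟩
  rw [← Nat.card_eq_of_bijective f hf]
  have := Fintype.ofFinite Z
  have := Fintype.ofFinite W
  rw [Nat.card_sigma, Nat.card_eq_fintype_card, ← Finset.card_univ, ← smul_eq_mul,
    ← Finset.sum_const]
  refine Finset.sum_congr rfl fun l _ => ?_
  rw [← hN l.1 l.2, Nat.card_eq_fintype_card, AddChar.card_eq, Nat.card_eq_fintype_card]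

end ClassTwo

section SkewCount

variable {F : Type} [Field F] {m : Type} [Fintype m]

/-- The matrix `C` bordered skew-symmetrically by the column `v`. -/
def border (C : Matrix m m F) (v : m → F) : Matrix (m ⊕ Unit) (m ⊕ Unit) F :=
  fromBlocks C (replicateCol Unit v) (-replicateRow Unit v) 0

theorem border_mulVec (C : Matrix m m F) (v : m → F) (x : m ⊕ Unit → F) :
    border C v *ᵥ x = 0 ↔
      C *ᵥ (x ∘ Sum.inl) + x (Sum.inr ()) • v = 0 ∧ v ⬝ᵥ (x ∘ Sum.inl) = 0 := by
  rw [border, fromBlocks_mulVec]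
  constructor
  · intro h
    refine ⟨funext fun i => ?_, ?_⟩
    · have := congrFun h (Sum.inl i)
      simpa [mulVec, dotProduct, mul_comm] using this
    · have := congrFun h (Sum.inr ())
      simpa [mulVec, dotProduct] using this
  · rintro ⟨h1, h2⟩
    ext (i | i)
    · have := congrFun h1 i
      simpa [mulVec, dotProduct, mul_comm] using this
    · simpa [mulVec, dotProduct] using h2

theorem dotProduct_mulVec_skew {C : Matrix m m F} (hC : Cᵀ = -C) (x y : m → F) :
    x ⬝ᵥ C *ᵥ y = -((C *ᵥ x) ⬝ᵥ y) := by
  rw [dotProduct_mulVec, ← mulVec_transpose, hC, neg_mulVec, neg_dotProduct]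

theorem dotProduct_mulVec_self_skew (h2 : (2 : F) ≠ 0) {C : Matrix m m F} (hC : Cᵀ = -C)
    (x : m → F) : x ⬝ᵥ C *ᵥ x = 0 := by
  have h := dotProduct_mulVec_skew hC x x
  rw [dotProduct_comm (C *ᵥ x)] at h
  have : 2 * (x ⬝ᵥ C *ᵥ x) = 0 := by linear_combination h
  exact (mul_eq_zero.mp this).resolve_left h2

theorem exists_mulVec_eq_of_skew [DecidableEq m] {C : Matrix m m F} (hC : Cᵀ = -C) (v : m → F)
    (h : ∀ x, C *ᵥ x = 0 → v ⬝ᵥ x = 0) : ∃ w, C *ᵥ w = v := by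
  have hmem : dotProductEquiv F m v ∈ LinearMap.range C.mulVecLin.dualMap := by
    rw [LinearMap.range_dualMap_eq_dualAnnihilator_ker, Submodule.mem_dualAnnihilator]
    intro x hx
    exact h x hx
  obtain ⟨ℓ, hℓ⟩ := hmem
  obtain ⟨u, rfl⟩ := (dotProductEquiv F m).surjective ℓ
  refine ⟨-u, ?_⟩
  have hx : ∀ x, u ⬝ᵥ C *ᵥ x = v ⬝ᵥ x := fun x => LinearMap.congr_fun hℓ x
  apply dotProduct_eq
  intro x
  rw [← hx x, dotProduct_mulVec_skew hC, mulVec_neg, neg_dotProduct]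

theorem rank_add_finrank_ker (C : Matrix m m F) :
    C.rank + Module.finrank F (LinearMap.ker C.mulVecLin) = Fintype.card m := by
  rw [Matrix.rank, LinearMap.finrank_range_add_finrank_ker, Module.finrank_fintype_fun_eq_card]

theorem rank_border_of_mem (h2 : (2 : F) ≠ 0) {C : Matrix m m F} (hC : Cᵀ = -C) (v : m → F)
    (hv : ∃ w, C *ᵥ w = v) : (border C v).rank = C.rank := by
  obtain ⟨w, rfl⟩ := hv
  let f : (LinearMap.ker C.mulVecLin × F) →ₗ[F] (m ⊕ Unit → F) :=
    { toFun := fun p => Sum.elim (p.1.1 - p.2 • w) (fun _ => p.2)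
      map_add' := fun p p' => by
        ext (i | i) <;> simp [add_mul]; ring
      map_smul' := fun c p => by
        ext (i | i) <;> simp [mul_sub, mul_assoc] }
  have hf : Function.Injective f := by
    rintro ⟨x, t⟩ ⟨x', t'⟩ h
    have ht : t = t' := congrFun h (Sum.inr ())
    subst ht
    have hx : x = x' := by
      ext i
      simpa [f] using congrFun h (Sum.inl i)
    rw [hx]
  have hr : LinearMap.range f = LinearMap.ker (border C (C *ᵥ w)).mulVecLin := by
    ext x
    rw [LinearMap.mem_ker, mulVecLin_apply, border_mulVec]
    constructor
    · rintro ⟨⟨⟨y, hy⟩, t⟩, rfl⟩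
      replace hy : C *ᵥ y = 0 := hy
      have e : f (⟨y, hy⟩, t) ∘ Sum.inl = y - t • w := rfl
      have e' : f (⟨y, hy⟩, t) (Sum.inr ()) = t := rfl
      rw [e, e', mulVec_sub, mulVec_smul, hy]
      refine ⟨by simp, ?_⟩
      rw [dotProduct_sub, dotProduct_smul, dotProduct_comm _ w, dotProduct_mulVec_self_skew h2 hC,
        smul_zero, sub_zero, ← neg_eq_zero, ← dotProduct_mulVec_skew hC, hy, dotProduct_zero]
    · rintro ⟨h1, -⟩
      refine ⟨⟨⟨x ∘ Sum.inl + x (Sum.inr ()) • w, ?_⟩, x (Sum.inr ())⟩, ?_⟩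
      · rw [LinearMap.mem_ker, mulVecLin_apply, mulVec_add, mulVec_smul, h1]
      · ext (i | i) <;> simp [f]
  have h3 := LinearMap.finrank_range_of_inj hf
  rw [hr, Module.finrank_prod, Module.finrank_self] at h3
  have h4 := rank_add_finrank_ker C
  have h5 := rank_add_finrank_ker (border C (C *ᵥ w))
  rw [Fintype.card_sum, Fintype.card_unit] at h5
  omega

theorem rank_border_of_not_mem [DecidableEq m] {C : Matrix m m F} (hC : Cᵀ = -C) (v : m → F)
    (hv : ¬ ∃ w, C *ᵥ w = v) : (border C v).rank = C.rank + 2 := by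
  let g : LinearMap.ker C.mulVecLin →ₗ[F] F :=
    (dotProductEquiv F m v : (m → F) →ₗ[F] F) ∘ₗ (LinearMap.ker C.mulVecLin).subtype
  have hg : Function.Surjective g := by
    apply LinearMap.surjective
    intro h0
    apply hv
    refine exists_mulVec_eq_of_skew hC v fun x hx => ?_
    exact LinearMap.congr_fun h0 ⟨x, hx⟩
  let f : LinearMap.ker g →ₗ[F] (m ⊕ Unit → F) :=
    { toFun := fun p => Sum.elim p.1.1 (fun _ => 0)
      map_add' := fun p p' => by
        ext (i | i) <;> simp
      map_smul' := fun c p => by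
        ext (i | i) <;> simp }
  have hf : Function.Injective f := by
    rintro x x' h
    ext i
    exact congrFun h (Sum.inl i)
  have hr : LinearMap.range f = LinearMap.ker (border C v).mulVecLin := by
    ext x
    rw [LinearMap.mem_ker, mulVecLin_apply, border_mulVec]
    constructor
    · rintro ⟨⟨⟨y, hy⟩, hgy⟩, rfl⟩
      replace hy : C *ᵥ y = 0 := hy
      exact ⟨by change C *ᵥ y + (0 : F) • v = 0; simp [hy], hgy⟩
    · rintro ⟨h1, h2⟩
      have ht : x (Sum.inr ()) = 0 := by
        by_contra ht
        apply hv
        refine ⟨-(x (Sum.inr ()))⁻¹ • (x ∘ Sum.inl), ?_⟩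
        rw [mulVec_smul, eq_neg_of_add_eq_zero_left h1, smul_neg, neg_smul, neg_neg, smul_smul,
          inv_mul_cancel₀ ht, one_smul]
      refine ⟨⟨⟨x ∘ Sum.inl, ?_⟩, h2⟩, ?_⟩
      · rw [LinearMap.mem_ker, mulVecLin_apply]
        simpa [ht] using h1
      · ext (i | i)
        · rfl
        · exact ht.symm
  have h3 := LinearMap.finrank_range_of_inj hf
  have h6 := LinearMap.finrank_range_add_finrank_ker g
  rw [LinearMap.range_eq_top.mpr hg, finrank_top, Module.finrank_self] at h6
  rw [hr] at h3
  have h4 := rank_add_finrank_ker C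
  have h5 := rank_add_finrank_ker (border C v)
  rw [Fintype.card_sum, Fintype.card_unit] at h5
  omega

variable (F) in
/-- The number of skew-symmetric matrices of rank `r` indexed by `m`. -/
noncomputable def skewCount (m : Type) [Fintype m] (r : ℕ) : ℕ :=
  Nat.card {C : Matrix m m F // Cᵀ = -C ∧ C.rank = r}

theorem skewCount_congr {m' : Type} [Fintype m'] (e : m ≃ m') (r : ℕ) :
    skewCount F m r = skewCount F m' r := by
  refine Nat.card_congr ((reindex e e).subtypeEquiv fun C => ?_)
  rw [rank_reindex, transpose_reindex]
  refine and_congr_left fun _ => ?_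
  rw [← (reindex e e).injective.eq_iff]
  rfl

/-- A skew-symmetric matrix on `m ⊕ Unit` is a bordered skew-symmetric matrix on `m`. -/
def borderEquiv (h2 : (2 : F) ≠ 0) :
    ({C : Matrix m m F // Cᵀ = -C} × (m → F)) ≃
      {C : Matrix (m ⊕ Unit) (m ⊕ Unit) F // Cᵀ = -C} where
  toFun p := ⟨border p.1.1 p.2, by
    rw [border, fromBlocks_transpose, fromBlocks_neg, p.1.2]
    congr 1 <;> simp⟩
  invFun C := (⟨C.1.toBlocks₁₁, by
    ext i j; exact congrFun (congrFun C.2 (Sum.inl i)) (Sum.inl j)⟩,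
    fun i => C.1 (Sum.inl i) (Sum.inr ()))
  left_inv p := rfl
  right_inv C := by
    ext (i | i) (j | j)
    · rfl
    · rfl
    · have := congrFun (congrFun C.2 (Sum.inr i)) (Sum.inl j)
      simpa [border, neg_eq_iff_eq_neg] using this
    · have := congrFun (congrFun C.2 (Sum.inr i)) (Sum.inr j)
      simp only [transpose_apply, Matrix.neg_apply] at this
      have h : 2 * C.1 (Sum.inr i) (Sum.inr j) = 0 := by linear_combination this
      exact ((mul_eq_zero.mp h).resolve_left h2).symm

open Classical in
theorem skewCount_eq_sum [Fintype {C : Matrix m m F // Cᵀ = -C}] (r : ℕ) : (skewCount F m r : ℚ) =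
    ∑ C : {C : Matrix m m F // Cᵀ = -C}, if C.1.rank = r then (1 : ℚ) else 0 := by
  rw [skewCount, ← Nat.card_congr (Equiv.subtypeSubtypeEquivSubtypeInter
    (fun C : Matrix m m F => Cᵀ = -C) fun C => C.rank = r), Nat.card_eq_fintype_card,
    Fintype.card_subtype, Finset.sum_boole]

theorem card_range_mulVec [Fintype F] (C : Matrix m m F) :
    Nat.card {v // ∃ w, C *ᵥ w = v} = Fintype.card F ^ C.rank := by
  rw [Matrix.rank, ← Nat.card_eq_fintype_card, ← Module.natCard_eq_pow_finrank]
  rfl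

open Classical in
theorem sum_border [Fintype F] (h2 : (2 : F) ≠ 0) (C : Matrix m m F) (hC : Cᵀ = -C) (r : ℕ) :
    (∑ v : m → F, if (border C v).rank = r then (1 : ℚ) else 0) =
      (Fintype.card F : ℚ) ^ C.rank * (if C.rank = r then 1 else 0) +
      ((Fintype.card F : ℚ) ^ Fintype.card m - (Fintype.card F : ℚ) ^ C.rank) *
        (if C.rank + 2 = r then 1 else 0) := by
  have h : ∀ v : m → F, (if (border C v).rank = r then (1 : ℚ) else 0) =
      (if ∃ w, C *ᵥ w = v then (1 : ℚ) else 0) *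
        ((if C.rank = r then 1 else 0) - if C.rank + 2 = r then 1 else 0) +
      if C.rank + 2 = r then 1 else 0 := by
    intro v
    by_cases hv : ∃ w, C *ᵥ w = v
    · rw [rank_border_of_mem h2 hC v hv, if_pos hv]; ring
    · rw [rank_border_of_not_mem hC v hv, if_neg hv]; ring
  have hr : (∑ v : m → F, if ∃ w, C *ᵥ w = v then (1 : ℚ) else 0) =
      (Fintype.card F : ℚ) ^ C.rank := by
    rw [Finset.sum_boole, ← Fintype.card_subtype, ← Nat.card_eq_fintype_card, card_range_mulVec]
    push_cast
    rfl
  have hc : ((Finset.univ : Finset (m → F)).card : ℚ) = (Fintype.card F : ℚ) ^ Fintype.card m := by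
    rw [Finset.card_univ, Fintype.card_fun]
    push_cast
    rfl
  rw [Finset.sum_congr rfl fun v _ => h v, Finset.sum_add_distrib, ← Finset.sum_mul, hr,
    Finset.sum_const, nsmul_eq_mul, hc]
  ring

open Classical in
theorem skewCount_sum_unit [Fintype F] [Fintype {C : Matrix m m F // Cᵀ = -C}]
    (h2 : (2 : F) ≠ 0) (r : ℕ) :
    (skewCount F (m ⊕ Unit) r : ℚ) = (Fintype.card F : ℚ) ^ r * skewCount F m r +
      ∑ C : {C : Matrix m m F // Cᵀ = -C},
        ((Fintype.card F : ℚ) ^ Fintype.card m - (Fintype.card F : ℚ) ^ C.1.rank) *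
        (if C.1.rank + 2 = r then 1 else 0) := by
  rw [skewCount_eq_sum, skewCount_eq_sum, Finset.mul_sum, ← Finset.sum_add_distrib,
    ← Equiv.sum_comp (borderEquiv (m := m) h2)
      (fun C => if C.1.rank = r then (1 : ℚ) else 0), Fintype.sum_prod_type]
  refine Finset.sum_congr rfl fun C _ => ?_
  refine (sum_border h2 C.1 C.2 r).trans ?_
  congr 1
  split_ifs with h
  · rw [h]
  · simp

/-- `Fin (d + 1)` as `Fin d` with a point added. -/
def finSumUnit (d : ℕ) : Fin (d + 1) ≃ Fin d ⊕ Unit :=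
  finSumFinEquiv.symm.trans (Equiv.sumCongr (Equiv.refl _) (Equiv.equivPUnit.{1, 1} (Fin 1)))

theorem skewCount_succ_add_two [Fintype F] (h2 : (2 : F) ≠ 0) (d r : ℕ) :
    (skewCount F (Fin (d + 1)) (r + 2) : ℚ) =
      (Fintype.card F : ℚ) ^ (r + 2) * skewCount F (Fin d) (r + 2) +
      ((Fintype.card F : ℚ) ^ d - (Fintype.card F : ℚ) ^ r) * skewCount F (Fin d) r := by
  classical
  rw [skewCount_congr (finSumUnit d),
    skewCount_sum_unit h2, skewCount_eq_sum (m := Fin d) r, Finset.mul_sum]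
  congr 1
  refine Finset.sum_congr rfl fun C _ => ?_
  simp only [Nat.add_right_cancel_iff, Fintype.card_fin]
  split_ifs with h
  · rw [h]
  · simp

theorem skewCount_succ_of_lt_two [Fintype F] (h2 : (2 : F) ≠ 0) (d r : ℕ) (hr : r < 2) :
    (skewCount F (Fin (d + 1)) r : ℚ) = (Fintype.card F : ℚ) ^ r * skewCount F (Fin d) r := by
  classical
  rw [skewCount_congr (finSumUnit d),
    skewCount_sum_unit h2]
  simp only [add_eq_left]
  refine Finset.sum_eq_zero fun C _ => ?_
  rw [if_neg (by omega), mul_zero]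

theorem skewCount_zero [Fintype F] (r : ℕ) :
    skewCount F (Fin 0) r = if r = 0 then 1 else 0 := by
  rw [skewCount]
  have hz : ∀ C : Matrix (Fin 0) (Fin 0) F, C.rank = 0 := fun C => by
    simpa using C.rank_le_card_width
  split_ifs with h
  · rw [Nat.card_eq_one_iff_unique]
    exact ⟨⟨fun a b => Subtype.ext (Subsingleton.elim _ _)⟩, ⟨⟨0, by simp, by rw [hz, h]⟩⟩⟩
  · have : IsEmpty {C : Matrix (Fin 0) (Fin 0) F // Cᵀ = -C ∧ C.rank = r} :=
      ⟨fun C => h (by rw [← C.2.2, hz])⟩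
    exact Nat.card_of_isEmpty

theorem skewCount_odd [Fintype F] (h2 : (2 : F) ≠ 0) (d s : ℕ) :
    skewCount F (Fin d) (2 * s + 1) = 0 := by
  induction d generalizing s with
  | zero => rw [skewCount_zero]; simp
  | succ d ih =>
    have : (skewCount F (Fin (d + 1)) (2 * s + 1) : ℚ) = 0 := by
      cases s with
      | zero => rw [skewCount_succ_of_lt_two h2 _ _ (by norm_num), ih]; simp
      | succ s =>
        rw [show 2 * (s + 1) + 1 = (2 * s + 1) + 2 by ring, skewCount_succ_add_two h2, ih,
          show 2 * s + 1 + 2 = 2 * (s + 1) + 1 by ring, ih]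
        simp
    exact_mod_cast this

theorem even_rank_of_skew [Finite F] (h2 : (2 : F) ≠ 0) {d : ℕ} (C : Matrix (Fin d) (Fin d) F)
    (hC : Cᵀ = -C) : Even C.rank := by
  have := Fintype.ofFinite F
  by_contra h
  obtain ⟨s, hs⟩ := Nat.not_even_iff_odd.mp h
  have h0 := skewCount_odd h2 d s
  rw [skewCount, Nat.card_eq_zero] at h0
  rcases h0 with h0 | h0
  · exact h0.false ⟨C, hC, hs⟩
  · exact h0.not_finite inferInstance

theorem skewCount_even [Fintype F] (h2 : (2 : F) ≠ 0) (d s : ℕ) :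
    (skewCount F (Fin d) (2 * s) : ℚ) = (Fintype.card F : ℚ) ^ (s ^ 2 - s) *
      (∏ i ∈ Finset.range (2 * s), ((Fintype.card F : ℚ) ^ (d - i) - 1)) /
        ∏ i ∈ Finset.Icc 1 s, ((Fintype.card F : ℚ) ^ (2 * i) - 1) := by
  have hq : (1 : ℚ) < Fintype.card F := by exact_mod_cast Fintype.one_lt_card
  set Q : ℚ := (Fintype.card F : ℚ) with hQ
  induction d generalizing s with
  | zero =>
    rw [skewCount_zero]
    cases s with
    | zero => simp
    | succ s => simp
  | succ d ih =>
    cases s with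
    | zero =>
      have := ih 0
      rw [mul_zero, skewCount_succ_of_lt_two h2 _ _ (by norm_num)]
      simp at this ⊢
      exact_mod_cast this
    | succ s =>
      have hD : ∀ i, 1 ≤ i → Q ^ (2 * i) - 1 ≠ 0 := fun i hi =>
        (sub_pos.mpr (one_lt_pow₀ hq (by omega))).ne'
      have hP : ∏ i ∈ Finset.Icc 1 s, (Q ^ (2 * i) - 1) ≠ 0 :=
        Finset.prod_ne_zero_iff.mpr fun i hi => hD i (Finset.mem_Icc.mp hi).1
      rw [show 2 * (s + 1) = 2 * s + 2 by ring, skewCount_succ_add_two h2,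
        show 2 * s + 2 = 2 * (s + 1) by ring, ih s, ih (s + 1), ← hQ,
        Finset.prod_Icc_succ_top (by omega), show 2 * (s + 1) = 2 * s + 2 by ring]
      have hD' := hD (s + 1) (by omega)
      rw [show 2 * (s + 1) = 2 * s + 2 by ring] at hD'
      have he : (s + 1) ^ 2 - (s + 1) = (s ^ 2 - s) + 2 * s := by
        have : s ≤ s ^ 2 := Nat.le_self_pow two_ne_zero s
        zify [this, show s + 1 ≤ (s + 1) ^ 2 from Nat.le_self_pow two_ne_zero _]
        ring
      rw [he]
      have hP1 : ∏ i ∈ Finset.range (2 * s + 2), (Q ^ (d + 1 - i) - 1) =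
          (∏ i ∈ Finset.range (2 * s), (Q ^ (d - i) - 1)) * (Q ^ (d - 2 * s) - 1) *
            (Q ^ (d + 1) - 1) := by
        rw [Finset.prod_range_succ' _ (2 * s + 1)]
        simp only [Nat.add_sub_add_right, Nat.sub_zero]
        rw [Finset.prod_range_succ]
      have hP2 : ∏ i ∈ Finset.range (2 * s + 2), (Q ^ (d - i) - 1) =
          (∏ i ∈ Finset.range (2 * s), (Q ^ (d - i) - 1)) * (Q ^ (d - 2 * s) - 1) *
            (Q ^ (d - (2 * s + 1)) - 1) := by
        rw [Finset.prod_range_succ, Finset.prod_range_succ]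
      rw [hP1, hP2]
      set P := ∏ i ∈ Finset.range (2 * s), (Q ^ (d - i) - 1) with hPdef
      have key : P * (Q ^ (d - 2 * s) - 1) * (Q ^ (d + 1) - 1) * Q ^ (2 * s)  =
          Q ^ (2 * s + 2) * (P * (Q ^ (d - 2 * s) - 1) * (Q ^ (d - (2 * s + 1)) - 1)) * Q ^ (2 * s)
          + (Q ^ d - Q ^ (2 * s)) * P * (Q ^ (2 * s + 2) - 1) := by
        rcases lt_trichotomy d (2 * s) with h | h | h
        · have : P = 0 := Finset.prod_eq_zero (i := d) (Finset.mem_range.mpr h) (by simp)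
          simp [this]
        · subst h
          simp
        · obtain ⟨t, rfl⟩ : ∃ t, d = 2 * s + 1 + t := ⟨d - (2 * s + 1), by omega⟩
          rw [show 2 * s + 1 + t - 2 * s = t + 1 by omega, Nat.add_sub_cancel_left]
          ring
      rw [pow_add Q (s ^ 2 - s)]
      field_simp
      linear_combination -key

end SkewCount

section Coordinates

variable {F : Type} [Field F] {n d : ℕ}

variable (F d) in
/-- The additive group of skew-symmetric `d×d` matrices. -/
def skewMatrices : AddSubgroup (Matrix (Fin d) (Fin d) F) where
  carrier := {S | Sᵀ = -S}
  add_mem' := fun {a b} ha hb => by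
    change (a + b)ᵀ = -(a + b)
    rw [transpose_add, show aᵀ = -a from ha, show bᵀ = -b from hb, neg_add]
  zero_mem' := by simp
  neg_mem' := fun {a} ha => by
    change (-a)ᵀ = - -a
    rw [transpose_neg, show aᵀ = -a from ha]

variable (F n d) in
/-- The pairs `(A, B)` of off-diagonal blocks. -/
abbrev BlockPair := Matrix (Fin d) (Fin (n - d)) F × Matrix (Fin d) (Fin (n - d)) F

variable (F n d) in
/-- The cocycle `((A, B), (X, Y)) ↦ YAᵀ - AYᵀ` describing the multiplication of `RuD`. -/
def cocycle : BlockPair F n d →+ BlockPair F n d →+ skewMatrices F d :=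
  AddMonoidHom.mk' (fun w => AddMonoidHom.mk'
    (fun x => ⟨x.2 * w.1ᵀ - w.1 * x.2ᵀ, by
      change (_ : Matrix _ _ F) = _
      simp [transpose_sub, transpose_mul]⟩)
    (fun x y => by
      ext1
      simp only [Prod.snd_add, transpose_add, AddSubgroup.coe_add, Matrix.add_mul, Matrix.mul_add]
      abel))
    (fun x y => by
      ext1 z
      ext1
      simp only [AddMonoidHom.mk'_apply, AddMonoidHom.add_apply, Prod.fst_add, transpose_add,
        AddSubgroup.coe_add, Matrix.add_mul, Matrix.mul_add]
      abel)

theorem coe_cocycle (w x : BlockPair F n d) :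
    (cocycle F n d w x : Matrix (Fin d) (Fin d) F) = x.2 * w.1ᵀ - w.1 * x.2ᵀ := rfl

/-- The element of `RuD` with blocks `(A, B)` and skew part `S`. -/
def ruMatrix (x : BlockPair F n d × skewMatrices F d) : Matrix (κ n d) (κ n d) F :=
  fromBlocks (fromBlocks 1 x.1.1 0 1)
    (fromBlocks (x.2.1 - x.1.2 * x.1.1ᵀ) x.1.2 (-x.1.2ᵀ) 0) 0 (fromBlocks 1 0 (-x.1.1ᵀ) 1)

theorem ruMatrix_injective : Function.Injective (ruMatrix (F := F) (n := n) (d := d)) := by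
  rintro ⟨⟨A, B⟩, S⟩ ⟨⟨A', B'⟩, S'⟩ h
  simp only [ruMatrix, fromBlocks_inj] at h
  obtain ⟨⟨-, rfl, -, -⟩, ⟨h1, rfl, -, -⟩, -⟩ := h
  rw [sub_left_inj] at h1
  rw [Subtype.ext h1]

theorem ruMatrix_mul (x y : BlockPair F n d × skewMatrices F d) :
    ruMatrix x * ruMatrix y = ruMatrix (x.1 + y.1, x.2 + y.2 + cocycle F n d x.1 y.1) := by
  obtain ⟨⟨A, B⟩, S⟩ := x
  obtain ⟨⟨A', B'⟩, S'⟩ := y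
  simp only [ruMatrix, fromBlocks_multiply, fromBlocks_add, fromBlocks_inj, coe_cocycle,
    AddSubgroup.coe_add, Prod.fst_add, Prod.snd_add, transpose_add, Matrix.mul_add, Matrix.add_mul,
    Matrix.mul_zero, Matrix.zero_mul, Matrix.one_mul, Matrix.mul_one, add_zero, zero_add,
    Matrix.mul_neg, neg_zero, true_and, and_true]
  refine ⟨?_, ⟨?_, ?_, ?_⟩, ?_⟩ <;> abel

theorem Umat_transpose_inv (A : Matrix (Fin d) (Fin (n - d)) F) :
    ((Umat F n d A)ᵀ)⁻¹ = fromBlocks 1 0 (-Aᵀ) 1 := by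
  apply Matrix.inv_eq_right_inv
  rw [Umat, fromBlocks_transpose, fromBlocks_multiply]
  simp [← fromBlocks_one]

theorem mem_RuD_iff (g : Matrix (κ n d) (κ n d) F) :
    g ∈ RuD F n d ↔ ∃ x, ruMatrix x = g := by
  constructor
  · rintro ⟨A, V, ⟨hV, h0⟩, rfl⟩
    have hS : V.toBlocks₁₁ᵀ = -V.toBlocks₁₁ := by
      ext i j; exact congrFun (congrFun hV (Sum.inl i)) (Sum.inl j)
    refine ⟨((A, V.toBlocks₁₂), ⟨V.toBlocks₁₁, hS⟩), ?_⟩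
    have hVb : V = fromBlocks V.toBlocks₁₁ V.toBlocks₁₂ (-V.toBlocks₁₂ᵀ) 0 := by
      ext (i | i) (j | j)
      · rfl
      · rfl
      · exact neg_eq_iff_eq_neg.mp (congrFun (congrFun hV (Sum.inr i)) (Sum.inl j)).symm
      · exact h0 i j
    conv_rhs => rw [hVb]
    rw [Umat_transpose_inv, fromBlocks_multiply, ruMatrix, Umat]
    simp [sub_eq_add_neg]
  · rintro ⟨⟨⟨A, B⟩, ⟨S, hS⟩⟩, rfl⟩
    replace hS : Sᵀ = -S := hS
    refine ⟨A, fromBlocks S B (-Bᵀ) 0, ⟨?_, fun i j => rfl⟩, ?_⟩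
    · rw [fromBlocks_transpose, fromBlocks_neg, hS]
      simp
    · rw [Umat_transpose_inv, fromBlocks_multiply, ruMatrix, Umat]
      simp [sub_eq_add_neg]

theorem ruMatrix_zero : ruMatrix (0 : BlockPair F n d × skewMatrices F d) = 1 := by
  simp [ruMatrix]

theorem isUnit_ruMatrix (x : BlockPair F n d × skewMatrices F d) : IsUnit (ruMatrix x) := by
  have h : ruMatrix x * ruMatrix (-x.1, -x.2 + cocycle F n d x.1 x.1) = 1 := by
    rw [ruMatrix_mul, ← ruMatrix_zero]
    congr 1
    ext1 <;> simp
  exact IsUnit.of_mul_eq_one _ h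

/-- The coordinates `((A, B), S)` on `RuD`. -/
theorem exists_coordinates (G : Subgroup (Matrix (κ n d) (κ n d) F)ˣ)
    (hG : ∀ u : (Matrix (κ n d) (κ n d) F)ˣ,
      u ∈ G ↔ (u : Matrix (κ n d) (κ n d) F) ∈ RuD F n d) :
    ∃ φ : G ≃ BlockPair F n d × skewMatrices F d, ∀ g h, φ (g * h) =
      ((φ g).1 + (φ h).1, (φ g).2 + (φ h).2 + cocycle F n d (φ g).1 (φ h).1) := by
  let f : BlockPair F n d × skewMatrices F d → G := fun x =>
    ⟨(isUnit_ruMatrix x).unit, (hG _).mpr ((mem_RuD_iff _).mpr ⟨x, rfl⟩)⟩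
  have hfv : ∀ x, ((f x : (Matrix (κ n d) (κ n d) F)ˣ) : Matrix (κ n d) (κ n d) F) =
    ruMatrix x := fun x => rfl
  have hf : Function.Bijective f := by
    constructor
    · intro x y h
      apply ruMatrix_injective
      rw [← hfv, ← hfv, h]
    · rintro ⟨u, hu⟩
      obtain ⟨x, hx⟩ := (mem_RuD_iff _).mp ((hG u).mp hu)
      exact ⟨x, Subtype.ext (Units.ext hx)⟩
  refine ⟨(Equiv.ofBijective f hf).symm, fun g h => ?_⟩
  obtain ⟨x, rfl⟩ := hf.2 g
  obtain ⟨y, rfl⟩ := hf.2 h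
  rw [Equiv.symm_apply_eq]
  simp only [Equiv.ofBijective_symm_apply_apply, Equiv.ofBijective_apply]
  exact Subtype.ext (Units.ext (ruMatrix_mul x y))

end Coordinates

section CentralCharacters

variable {F : Type} [Field F] {n d : ℕ}

/-- The character `S ↦ ψ(tr(CS))` of the group of skew-symmetric matrices. -/
def traceChar (ψ : AddChar F ℂ) (C : skewMatrices F d) : AddChar (skewMatrices F d) ℂ where
  toFun S := ψ (trace (C.1 * S.1))
  map_zero_eq_one' := by simp
  map_add_eq_mul' := fun a b => by simp [Matrix.mul_add, AddChar.map_add_eq_mul]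

theorem traceChar_apply (ψ : AddChar F ℂ) (C S : skewMatrices F d) :
    traceChar ψ C S = ψ (trace (C.1 * S.1)) := rfl

theorem eq_zero_of_forall_char_eq_one {ψ : AddChar F ℂ} (hψ : ψ.IsPrimitive) (a : F)
    (h : ∀ t, ψ (a * t) = 1) : a = 0 := by
  by_contra ha
  apply hψ ha
  ext t
  simpa [AddChar.mulShift_apply] using h t

theorem traceChar_injective {ψ : AddChar F ℂ} (hψ : ψ.IsPrimitive) (h2 : (2 : F) ≠ 0) :
    Function.Injective (traceChar (d := d) ψ) := by
  intro C C' h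
  have hS : ∀ S : skewMatrices F d, ψ (trace ((C - C').1 * S.1)) = 1 := by
    intro S
    rw [AddSubgroup.coe_sub, Matrix.sub_mul, trace_sub, AddChar.map_sub_eq_div,
      ← traceChar_apply, ← traceChar_apply, h, div_self (AddChar.val_isUnit _ _).ne_zero]
  rw [← sub_eq_zero]
  set D := C - C'
  ext i j
  have hD : D.1 j i = - D.1 i j := congrFun (congrFun D.2 i) j
  have key : 2 * D.1 i j = 0 := by
    apply eq_zero_of_forall_char_eq_one hψ
    intro t
    have := hS ⟨Matrix.single j i t - Matrix.single i j t, by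
      change (_ : Matrix _ _ F) = _
      simp⟩
    rw [← this]
    congr 1
    simp only [Matrix.mul_sub, trace_sub, trace_mul_single, hD, op_smul_eq_smul, smul_eq_mul]
    ring
  exact (mul_eq_zero.mp key).resolve_left h2

theorem traceChar_bijective [Finite F] {ψ : AddChar F ℂ} (hψ : ψ.IsPrimitive) (h2 : (2 : F) ≠ 0) :
    Function.Bijective (traceChar (d := d) ψ) := by
  have := Fintype.ofFinite (skewMatrices F d)
  exact (Fintype.bijective_iff_injective_and_card _).mpr
    ⟨traceChar_injective hψ h2, AddChar.card_eq.symm⟩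

theorem trace_skew_mul {C : Matrix (Fin d) (Fin d) F} (hC : Cᵀ = -C)
    (A B : Matrix (Fin d) (Fin (n - d)) F) :
    trace (C * (B * Aᵀ)) = -trace (C * (A * Bᵀ)) := by
  rw [← trace_transpose, transpose_mul, transpose_mul, hC, transpose_transpose, Matrix.mul_neg,
    trace_neg, trace_mul_comm]

theorem mem_charRadical_traceChar {ψ : AddChar F ℂ} (hψ : ψ.IsPrimitive) (h2 : (2 : F) ≠ 0)
    (C : skewMatrices F d) (w : BlockPair F n d) :
    w ∈ charRadical (cocycle F n d) (traceChar ψ C) ↔ C.1 * w.1 = 0 ∧ C.1 * w.2 = 0 := by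
  have hdiv : ∀ x : BlockPair F n d,
      traceChar ψ C (cocycle F n d w x) = traceChar ψ C (cocycle F n d x w) ↔
        ψ (-2 * (trace (C.1 * w.1 * x.2ᵀ) + trace (C.1 * w.2 * x.1ᵀ))) = 1 := by
    intro x
    rw [← div_eq_one_iff_eq (AddChar.val_isUnit _ _).ne_zero, ← AddChar.map_sub_eq_div,
      traceChar_apply]
    simp only [AddSubgroup.coe_sub, coe_cocycle, Matrix.mul_sub, trace_sub]
    rw [trace_skew_mul C.2 w.1 x.2, trace_skew_mul C.2 x.1 w.2 |> neg_eq_iff_eq_neg.mpr |>.symm]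
    rw [Matrix.mul_assoc, Matrix.mul_assoc]
    congr! 2
    ring
  constructor
  · intro h
    have hx := fun x => (hdiv x).mp (h x)
    have h2' : (-2 : F) ≠ 0 := neg_ne_zero.mpr h2
    constructor
    · ext i j
      have : -2 * (C.1 * w.1) i j = 0 := eq_zero_of_forall_char_eq_one hψ _ fun t => by
        rw [← hx (0, Matrix.single i j t)]
        simp [trace_mul_single, mul_assoc]
      exact (mul_eq_zero.mp this).resolve_left h2'
    · ext i j
      have : -2 * (C.1 * w.2) i j = 0 := eq_zero_of_forall_char_eq_one hψ _ fun t => by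
        rw [← hx (Matrix.single i j t, 0)]
        simp [trace_mul_single, mul_assoc]
      exact (mul_eq_zero.mp this).resolve_left h2'
  · rintro ⟨h1, h2⟩ x
    rw [hdiv, h1, h2]
    simp

theorem traceChar_cocycle_eq_one {ψ : AddChar F ℂ} (C : skewMatrices F d) (w x : BlockPair F n d)
    (hw : C.1 * w.1 = 0) (hx : C.1 * x.2 = 0) : traceChar ψ C (cocycle F n d w x) = 1 := by
  rw [traceChar_apply, coe_cocycle, Matrix.mul_sub, ← Matrix.mul_assoc, ← Matrix.mul_assoc, hw, hx]
  simp

theorem card_annihilated [Fintype F] (C : Matrix (Fin d) (Fin d) F) (k : ℕ) :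
    Nat.card {A : Matrix (Fin d) (Fin k) F // C * A = 0} =
      Fintype.card F ^ ((d - C.rank) * k) := by
  let e : {A : Matrix (Fin d) (Fin k) F // C * A = 0} ≃
      (Fin k → LinearMap.ker C.mulVecLin) :=
    { toFun := fun A j => ⟨A.1.col j, by
        rw [LinearMap.mem_ker, mulVecLin_apply]
        ext i
        exact congrFun (congrFun A.2 i) j⟩
      invFun := fun f => ⟨Matrix.of fun i j => (f j).1 i, by
        ext i j
        exact congrFun (f j).2 i⟩
      left_inv := fun A => rfl
      right_inv := fun f => rfl }
  have hk := rank_add_finrank_ker C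
  rw [Fintype.card_fin] at hk
  rw [Nat.card_congr e, Nat.card_fun, Nat.card_eq_fintype_card (α := Fin k), Fintype.card_fin,
    Module.natCard_eq_pow_finrank (K := F), Nat.card_eq_fintype_card, ← pow_mul,
    Nat.eq_sub_of_add_eq' hk]

theorem card_charRadical [Fintype F] {ψ : AddChar F ℂ} (hψ : ψ.IsPrimitive) (h2 : (2 : F) ≠ 0)
    (C : skewMatrices F d) :
    Nat.card (charRadical (cocycle F n d) (traceChar ψ C)) =
      Fintype.card F ^ (2 * ((d - C.1.rank) * (n - d))) := by
  have e : charRadical (cocycle F n d) (traceChar ψ C) ≃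
      {A : Matrix (Fin d) (Fin (n - d)) F // C.1 * A = 0} ×
        {A : Matrix (Fin d) (Fin (n - d)) F // C.1 * A = 0} :=
    (Equiv.subtypeEquivRight (mem_charRadical_traceChar hψ h2 C)).trans
      (Equiv.subtypeProdEquivProd (p := fun A : Matrix (Fin d) (Fin (n - d)) F => C.1 * A = 0)
        (q := fun A : Matrix (Fin d) (Fin (n - d)) F => C.1 * A = 0))
  rw [Nat.card_congr e, Nat.card_prod, card_annihilated, two_mul, pow_add]

theorem sqrt_index_charRadical [Fintype F] {ψ : AddChar F ℂ} (hψ : ψ.IsPrimitive)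
    (h2 : (2 : F) ≠ 0) (C : skewMatrices F d) :
    Nat.sqrt (charRadical (cocycle F n d) (traceChar ψ C)).index =
      Fintype.card F ^ (C.1.rank * (n - d)) := by
  have h := (charRadical (cocycle F n d) (traceChar ψ C)).card_mul_index
  have hr : C.1.rank ≤ d := by simpa using C.1.rank_le_card_width
  have hW : Nat.card (BlockPair F n d) = Fintype.card F ^ (2 * ((d - C.1.rank) * (n - d))) *
      (Fintype.card F ^ (C.1.rank * (n - d))) ^ 2 := by
    have hM : Nat.card (Matrix (Fin d) (Fin (n - d)) F) = Fintype.card F ^ (d * (n - d)) := by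
      rw [Matrix, Nat.card_fun, Nat.card_fun]
      simp [← pow_mul, mul_comm]
    rw [Nat.card_prod, hM, ← pow_mul, ← pow_add, ← pow_add]
    congr 1
    have hsplit : d * (n - d) = (d - C.1.rank) * (n - d) + C.1.rank * (n - d) := by
      rw [← add_mul, Nat.sub_add_cancel hr]
    lia
  rw [card_charRadical hψ h2, hW] at h
  rw [Nat.eq_of_mul_eq_mul_left (pow_pos Fintype.card_pos _) h, Nat.sqrt_eq']

end CentralCharacters

section Count

variable {F : Type} [Field F] {n d : ℕ}

theorem exists_isPrimitive_addChar (F : Type) [Field F] [Finite F] :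
    ∃ ψ : AddChar F ℂ, ψ.IsPrimitive := by
  obtain ⟨ψ, hψ⟩ := AddChar.exists_apply_ne_zero.mpr (one_ne_zero (α := F))
  refine ⟨ψ, AddChar.IsPrimitive.of_ne_one ?_⟩
  rintro rfl
  simp at hψ

theorem cocycle_eq_one_of_mem_charRadical [Finite F] {ψ : AddChar F ℂ} (hψ : ψ.IsPrimitive)
    (h2 : (2 : F) ≠ 0) (l : AddChar (skewMatrices F d) ℂ) (w : BlockPair F n d)
    (hw : w ∈ charRadical (cocycle F n d) l) (x : BlockPair F n d)
    (hx : x ∈ charRadical (cocycle F n d) l) : l (cocycle F n d w x) = 1 := by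
  obtain ⟨C, rfl⟩ := (traceChar_bijective hψ h2).2 l
  rw [mem_charRadical_traceChar hψ h2] at hw hx
  exact traceChar_cocycle_eq_one C w x hw.1 hx.2

theorem card_centralChars_rank [Finite F] {ψ : AddChar F ℂ} (hψ : ψ.IsPrimitive)
    (h2 : (2 : F) ≠ 0) (P : AddChar (skewMatrices F d) ℂ → Prop) (r : ℕ)
    (hP : ∀ C, P (traceChar ψ C) ↔ C.1.rank = r) :
    Nat.card {l // P l} = skewCount F (Fin d) r := by
  let e : {C : skewMatrices F d // C.1.rank = r} ≃ {l // P l} :=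
    (Equiv.ofBijective _ (traceChar_bijective hψ h2)).subtypeEquiv fun C => (hP C).symm
  rw [← Nat.card_congr e, skewCount]
  exact Nat.card_congr 
    (Equiv.subtypeSubtypeEquivSubtypeInter (fun C : Matrix (Fin d) (Fin d) F => Cᵀ = -C)
      fun C => C.rank = r)

theorem exists_skew_rank_eq [Fintype F] (h2 : (2 : F) ≠ 0) {s : ℕ} (hs : 2 * s ≤ d) :
    ∃ C : skewMatrices F d, C.1.rank = 2 * s := by
  have hq : (1 : ℚ) < Fintype.card F := by exact_mod_cast Fintype.one_lt_card
  have hpos : (0 : ℚ) < skewCount F (Fin d) (2 * s) := by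
    rw [skewCount_even h2]
    refine div_pos (mul_pos (by positivity) (Finset.prod_pos fun i hi => ?_))
      (Finset.prod_pos fun i hi => ?_)
    · rw [Finset.mem_range] at hi
      exact sub_pos.mpr (one_lt_pow₀ hq (by omega))
    · rw [Finset.mem_Icc] at hi
      exact sub_pos.mpr (one_lt_pow₀ hq (by omega))
  obtain ⟨C, hC, hr⟩ := (Nat.card_pos_iff.mp (Nat.cast_pos.mp hpos)).1
  exact ⟨⟨C, hC⟩, hr⟩

end Count

/-- the explicit count of irreducible characters of `R_u^{D,d}` of degree
`q^e`, `e = 2(n−d)s`, and the determination of the set of degrees. -/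
theorem ruD_char_count_explicit
    (p k q : ℕ) (hp : p.Prime) (hpodd : Odd p) (hk : 1 ≤ k) (hq : q = p ^ k)
    (F : Type) [Field F] [Fintype F] (hF : Fintype.card F = q)
    (n d : ℕ) (hd : 1 ≤ d) (hdn : d < n - 1)
    (G : Subgroup (Matrix (κ n d) (κ n d) F)ˣ)
    (hG : ∀ u : (Matrix (κ n d) (κ n d) F)ˣ,
      u ∈ G ↔ (u : Matrix (κ n d) (κ n d) F) ∈ RuD F n d)
    (s e : ℕ) (hs : 2 * s ≤ d) (he : e = 2 * (n - d) * s) :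
    (Nat.card {χ : ↥G → ℂ |
        (∃ V : FDRep ℂ ↥G, CategoryTheory.Simple V ∧ FDRep.character V = χ) ∧
        χ 1 = (q : ℂ) ^ e} : ℚ) =
      (q : ℚ) ^ (2 * d * (n - d) - 2 * e + s ^ 2 - s) *
        (∏ i ∈ Finset.range (2 * s), ((q : ℚ) ^ (d - i) - 1)) /
          ∏ i ∈ Finset.Icc 1 s, ((q : ℚ) ^ (2 * i) - 1) ∧
    {m : ℕ | ∃ V : FDRep ℂ ↥G, CategoryTheory.Simple V ∧ FDRep.character V 1 = (m : ℂ)} =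
      {m : ℕ | ∃ s' : ℕ, 2 * s' ≤ d ∧ m = q ^ (2 * (n - d) * s')} := by
  subst hF
  have h2 : (2 : F) ≠ 0 := by
    apply Ring.two_ne_zero
    intro hchar
    have h := FiniteField.even_card_of_char_two hchar
    rw [hq, Nat.pow_mod, Nat.odd_iff.mp hpodd] at h
    simp at h
  have hcard : 1 < Fintype.card F := Fintype.one_lt_card
  obtain ⟨ψ, hψ⟩ := exists_isPrimitive_addChar F
  obtain ⟨φ, hφ⟩ := exists_coordinates G hG
  have : Finite G := Finite.of_equiv _ φ.symm
  have hβ := cocycle_eq_one_of_mem_charRadical (n := n) (d := d) hψ h2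
  have hsurj := (traceChar_bijective (d := d) hψ h2).2
  have hdeg : ∀ C : skewMatrices F d,
      Nat.sqrt (charRadical (cocycle F n d) (traceChar ψ C)).index = Fintype.card F ^ e ↔
        C.1.rank = 2 * s := by
    intro C
    rw [sqrt_index_charRadical hψ h2, (Nat.pow_right_injective hcard).eq_iff, he,
      show 2 * (n - d) * s = 2 * s * (n - d) by ring, Nat.mul_left_inj (by omega)]
  constructor
  · have hcount := card_irreducible_characters (cocycle F n d) φ hφ hβ (Fintype.card F ^ e)
      (Fintype.card F ^ (2 * ((d - 2 * s) * (n - d)))) (fun l hl => by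
        obtain ⟨C, rfl⟩ := hsurj l
        rw [card_charRadical hψ h2, (hdeg C).mp hl])
    rw [card_centralChars_rank hψ h2 _ (2 * s) hdeg] at hcount
    push_cast at hcount
    rw [hcount]
    push_cast
    rw [skewCount_even h2, mul_comm, ← mul_div_assoc, ← mul_assoc, ← pow_add]
    congr 3
    have hsplit : d * (n - d) = (d - 2 * s) * (n - d) + 2 * s * (n - d) := by
      rw [← add_mul, Nat.sub_add_cancel hs]
    have hss : s ≤ s ^ 2 := Nat.le_self_pow two_ne_zero s
    have he' : e = 2 * s * (n - d) := by rw [he]; ring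
    rw [mul_assoc 2 d, hsplit, ← he']
    omega
  · ext m
    constructor
    · rintro ⟨V, hV, hm⟩
      obtain ⟨l, θ, hl⟩ := (exists_simple_iff _ φ hφ hβ V.character).mp ⟨V, hV, rfl⟩
      obtain ⟨C, rfl⟩ := hsurj l
      obtain ⟨t, ht⟩ := even_rank_of_skew h2 C.1 C.2
      have hr : C.1.rank ≤ d := by simpa using C.1.rank_le_card_width
      refine ⟨t, by omega, ?_⟩
      rw [← hl, classTwoChar_one _ φ hφ, sqrt_index_charRadical hψ h2, Nat.cast_inj, ht] at hm
      rw [← hm]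
      ring
    · rintro ⟨t, ht, rfl⟩
      obtain ⟨C, hC⟩ := exists_skew_rank_eq (F := F) h2 ht
      obtain ⟨V, hV, hχ⟩ := (exists_simple_iff _ φ hφ hβ _).mpr ⟨traceChar ψ C, 1, rfl⟩
      refine ⟨V, hV, ?_⟩
      rw [hχ, classTwoChar_one _ φ hφ, sqrt_index_charRadical hψ h2, hC]
      congr 2
      ring

end SOUnipotentRadical
end

section
/- Let q be a power of an odd prime and let n, d, r be integers with 1 ≤ d < n and 0 ≤ r ≤ d. Then the number of irreducible characters of R_u^{C,d} of degree q^{(n−d)r} equals q^{2d(n−d)−2(n−d)r} times the number of symmetric d×d matrices over 𝔽_q of rank r. Moreover, every irreducible character of R_u^{C,d} has degree q^{(n−d)r} for some integer r with 0 ≤ r ≤ d. -/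
open Matrix

namespace SpUnipotentRadical

/-- The index type for `n×n` matrices, split as `d + (n−d)`. -/
abbrev ι (n d : ℕ) := Fin d ⊕ Fin (n - d)

/-- The index type for `2n×2n` matrices, split as `n + n`. -/
abbrev κ (n d : ℕ) := ι n d ⊕ ι n d

/-- `U(A) = [[I_d, A],[0, I_{n−d}]]`. -/
def Umat (F : Type) [Field F] (n d : ℕ) (A : Matrix (Fin d) (Fin (n - d)) F) :
    Matrix (ι n d) (ι n d) F :=
  Matrix.fromBlocks 1 A 0 1

/-- `S_d`: symmetric `n×n` matrices whose lower-right `(n−d)×(n−d)` block is zero. -/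
def Sd (F : Type) [Field F] (n d : ℕ) : Set (Matrix (ι n d) (ι n d) F) :=
  {V | Vᵀ = V ∧ ∀ i j, V (Sum.inr i) (Sum.inr j) = 0}

/-- `R_u^{C,d} = { [[U(A), V·U(A)⁻ᵀ],[0, U(A)⁻ᵀ]] | A ∈ Mat_{d×(n−d)}, V ∈ S_d }`. -/
def RuC (F : Type) [Field F] (n d : ℕ) : Set (Matrix (κ n d) (κ n d) F) :=
  {g | ∃ (A : Matrix (Fin d) (Fin (n - d)) F) (V : Matrix (ι n d) (ι n d) F),
    V ∈ Sd F n d ∧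
    g = Matrix.fromBlocks (Umat F n d A) (V * ((Umat F n d A)ᵀ)⁻¹) 0 ((Umat F n d A)ᵀ)⁻¹}

end SpUnipotentRadical

section FiniteGroup

open CategoryTheory Module

variable {G : Type} [Group G]

/-- Schur's lemma: a linear endomorphism commuting with a simple representation is a scalar. -/
lemma FDRep.exists_eq_smul_one_of_commute (V : FDRep ℂ G) [Simple V] (f : V →ₗ[ℂ] V)
    (hf : ∀ g, f ∘ₗ V.ρ g = V.ρ g ∘ₗ f) : ∃ c : ℂ, f = c • (1 : V →ₗ[ℂ] V) := by
  let φ : V ⟶ V := Representation.linHom.invariantsEquivFDRepHom V V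
    ⟨f, fun g => by
      rw [Representation.linHom_apply, ← LinearMap.comp_assoc, ← hf g, LinearMap.comp_assoc,
        ← Module.End.mul_eq_comp (V.ρ g), ← map_mul, mul_inv_cancel, map_one]
      rfl⟩
  obtain ⟨c, hc⟩ := (finrank_eq_one_iff_of_nonzero' (𝟙 V) (id_nonzero V)).1
    (finrank_endomorphism_simple_eq_one ℂ V) φ
  refine ⟨c, ?_⟩
  have := congrArg
    (fun ψ : V ⟶ V => ((Representation.linHom.invariantsEquivFDRepHom V V).symm ψ).1) hc
  simp only [φ, LinearEquiv.symm_apply_apply] at this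
  rw [← this]
  rfl

lemma FDRep.simple_of_isIrreducible [Finite G] {W : Type} [AddCommGroup W] [Module ℂ W]
    [FiniteDimensional ℂ W] (ρ : Representation ℂ G W) [ρ.IsIrreducible] :
    Simple (FDRep.of ρ) := by
  classical
  have := Fintype.ofFinite G
  have hne : (Nat.card G : ℂ) ≠ 0 := by exact_mod_cast Nat.card_pos.ne'
  have := invertibleOfNonzero hne
  have h := Representation.char_orthonormal ρ ρ
  rw [if_pos ⟨Representation.Equiv.refl ρ⟩, inv_mul_eq_iff_eq_mul₀ hne, mul_one] at h
  rw [FDRep.simple_iff_char_is_norm_one]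
  exact h

/-- A nonzero finite-dimensional representation contains an irreducible one. -/
lemma Representation.exists_isIrreducible_toRepresentation {W : Type} [AddCommGroup W]
    [Module ℂ W] [FiniteDimensional ℂ W] [Nontrivial W] (ρ : Representation ℂ G W) :
    ∃ σ : Subrepresentation ρ, σ.toRepresentation.IsIrreducible := by
  classical
  have hex : ∃ n, ∃ σ : Subrepresentation ρ, σ.toSubmodule ≠ ⊥ ∧ finrank ℂ σ.toSubmodule = n :=
    ⟨_, ⟨⊤, fun _ _ _ => Submodule.mem_top⟩, top_ne_bot, rfl⟩
  obtain ⟨σ, hσ, hσn⟩ := Nat.find_spec hex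
  refine ⟨σ, { exists_pair_ne := ⟨⊥, ⊤, fun h => hσ ?_⟩, eq_bot_or_eq_top := fun τ => ?_ }⟩
  · rw [eq_bot_iff]
    intro x hx
    have : (⟨x, hx⟩ : σ.toSubmodule) ∈ (⊥ : Subrepresentation σ.toRepresentation) := by
      rw [h]; trivial
    simpa using congrArg Subtype.val ((Submodule.mem_bot ℂ).1 this)
  · by_cases hτ : τ.toSubmodule = ⊥
    · exact Or.inl (Subrepresentation.toSubmodule_injective hτ)
    · refine Or.inr (Subrepresentation.toSubmodule_injective ?_)
      let τ' : Subrepresentation ρ :=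
        ⟨τ.toSubmodule.map σ.toSubmodule.subtype, by
          rintro g _ ⟨x, hx, rfl⟩
          exact ⟨σ.toRepresentation g x, τ.apply_mem_toSubmodule g hx, rfl⟩⟩
      have hle := Nat.find_min' hex ⟨τ', fun h => hτ (Submodule.map_injective_of_injective
        σ.toSubmodule.injective_subtype (h.trans (Submodule.map_bot _).symm)), rfl⟩
      rw [← hσn, Submodule.finrank_map_subtype_eq] at hle
      exact Submodule.eq_top_of_finrank_eq (le_antisymm (Submodule.finrank_le _) hle)

/-- A linear character `lam` of a normal subgroup `K` which is invariant under conjugation lies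
under some simple representation, on which `K` acts through `lam`. -/
lemma FDRep.exists_simple_of_conj_invariant [Finite G] (K : Subgroup G) [K.Normal] (lam : G → ℂ)
    (h1 : lam 1 = 1) (hmul : ∀ x ∈ K, ∀ y ∈ K, lam (x * y) = lam x * lam y)
    (hconj : ∀ x ∈ K, ∀ g, lam (g * x * g⁻¹) = lam x) :
    ∃ V : FDRep ℂ G, Simple V ∧ ∀ x ∈ K, V.ρ x = lam x • (1 : V →ₗ[ℂ] V) := by
  classical
  let W : Submodule ℂ (G → ℂ) :=
    { carrier := {f | ∀ x ∈ K, ∀ g, f (x * g) = lam x * f g}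
      add_mem' := fun {f f'} hf hf' x hx g => by simp [hf x hx g, hf' x hx g, mul_add]
      zero_mem' := fun x hx g => by simp
      smul_mem' := fun c f hf x hx g => by simp [hf x hx g, mul_left_comm] }
  let ρ : Representation ℂ G W :=
    { toFun := fun h =>
        { toFun := fun f => ⟨fun g => f.1 (g * h), fun x hx g => by
            simpa only [mul_assoc] using f.2 x hx (g * h)⟩
          map_add' := fun _ _ => rfl
          map_smul' := fun _ _ => rfl }
      map_one' := by ext f g; simp
      map_mul' := fun h h' => by ext f g; simp [mul_assoc] }
  have hρ : ∀ x ∈ K, ρ x = lam x • (1 : W →ₗ[ℂ] W) := by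
    intro x hx
    ext f g
    have := f.2 (g * x * g⁻¹) (‹K.Normal›.conj_mem x hx g) g
    rw [inv_mul_cancel_right, hconj x hx] at this
    exact this
  have : Nontrivial W := by
    refine ⟨⟨fun g => if g ∈ K then lam g else 0, fun x hx g => ?_⟩, 0, fun h => ?_⟩
    · by_cases hg : g ∈ K
      · simp [hg, K.mul_mem hx hg, hmul x hx g hg]
      · simp [hg, K.mul_mem_cancel_left hx]
    · have := congrFun (congrArg Subtype.val h) 1
      simp [h1] at this
  obtain ⟨σ, hσ⟩ := ρ.exists_isIrreducible_toRepresentation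
  refine ⟨FDRep.of (V := σ.toSubmodule) σ.toRepresentation, FDRep.simple_of_isIrreducible _,
    fun x hx => ?_⟩
  refine LinearMap.ext fun v => Subtype.ext ?_
  exact LinearMap.congr_fun (hρ x hx) v.1

/-- The character of a simple representation on which `K` acts by the scalars `lam` vanishes at
`g` as soon as `g` is conjugate to a multiple `z * g` with `z ∈ K` and `lam z ≠ 1`. -/
lemma FDRep.character_eq_zero_of_conj (V : FDRep ℂ G) (K : Subgroup G) (lam : G → ℂ)
    (hV : ∀ x ∈ K, V.ρ x = lam x • (1 : V →ₗ[ℂ] V)) {g h z : G} (hz : z ∈ K)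
    (hlam : lam z ≠ 1) (hg : h * g = z * (g * h)) : V.character g = 0 := by
  have h1 : V.character (z * g) = lam z * V.character g := by
    simp [FDRep.character, hV z hz]
  have h2 : z * g = h * g * h⁻¹ := by rw [hg]; group
  rw [h2, FDRep.char_conj] at h1
  have : (1 - lam z) * V.character g = 0 := by linear_combination h1
  exact (mul_eq_zero.1 this).resolve_left (sub_ne_zero.2 (Ne.symm hlam))

lemma FDRep.finrank_sq_mul_card [Finite G] (V : FDRep ℂ G) [Simple V] (K : Subgroup G)
    (lam : G → ℂ) (hV : ∀ x ∈ K, V.ρ x = lam x • (1 : V →ₗ[ℂ] V))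
    (hvan : ∀ g ∉ K, V.character g = 0) :
    finrank ℂ V ^ 2 * Nat.card K = Nat.card G := by
  classical
  have := Fintype.ofFinite G
  have hne : (Nat.card G : ℂ) ≠ 0 := by exact_mod_cast Nat.card_pos.ne'
  have := invertibleOfNonzero hne
  have h := FDRep.char_orthonormal V V
  rw [if_pos ⟨Iso.refl V⟩, inv_mul_eq_iff_eq_mul₀ hne, mul_one] at h
  have hterm : ∀ g : G, V.character g * V.character g⁻¹ =
      if g ∈ K then (finrank ℂ V : ℂ) ^ 2 else 0 := by
    intro g
    split_ifs with hg
    · have hc : ∀ x ∈ K, V.character x = lam x * finrank ℂ V := fun x hx => by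
        simp [FDRep.character, hV x hx]
      have h2 : V.character (g * g⁻¹) = lam g * lam g⁻¹ * finrank ℂ V := by
        simp only [FDRep.character, map_mul, hV g hg, hV _ (K.inv_mem hg), smul_mul_smul_comm,
          mul_one, map_smul, smul_eq_mul, LinearMap.trace_one]
      rw [mul_inv_cancel, FDRep.char_one] at h2
      rw [hc g hg, hc _ (K.inv_mem hg)]
      linear_combination (-(finrank ℂ V : ℂ)) * h2
    · rw [hvan g hg, zero_mul]
  rw [Finset.sum_congr rfl fun g _ => hterm g, ← Finset.sum_filter, Finset.sum_const,
    nsmul_eq_mul] at h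
  have hK : Nat.card K = (Finset.univ.filter (· ∈ K)).card := by
    rw [Nat.card_eq_fintype_card, Fintype.card_subtype]
  rw [hK, mul_comm]
  exact_mod_cast h

end FiniteGroup

section SymmetricMatrices

open Module

variable {F δ μ : Type} [Field F] [Fintype δ] [Fintype μ]

/-- The additive group of symmetric matrices. -/
def symmetricMatrices (F δ : Type) [Field F] : AddSubgroup (Matrix δ δ F) where
  carrier := {S | Sᵀ = S}
  add_mem' := fun {S T} hS hT => by
    change (S + T)ᵀ = S + T
    rw [transpose_add, show Sᵀ = S from hS, show Tᵀ = T from hT]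
  zero_mem' := transpose_zero
  neg_mem' := fun {S} hS => by
    change (-S)ᵀ = -S
    rw [transpose_neg, show Sᵀ = S from hS]

lemma mem_symmetricMatrices {F δ : Type} [Field F] {S : Matrix δ δ F} :
    S ∈ symmetricMatrices F δ ↔ Sᵀ = S := Iff.rfl

/-- The radical of the alternating form attached to `M` on pairs of rectangular matrices. -/
def radical (μ : Type) (M : Matrix δ δ F) : AddSubgroup (Matrix δ μ F × Matrix δ μ F) where
  carrier := {x | M * x.1 = 0 ∧ M * x.2 = 0}
  add_mem' := fun {x y} hx hy => by
    simp [Matrix.mul_add, hx.1, hx.2, hy.1, hy.2]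
  zero_mem' := by simp
  neg_mem' := fun {x} hx => by simp [hx.1, hx.2]

lemma mem_radical {F δ μ : Type} [Field F] [Fintype δ] {M : Matrix δ δ F}
    {x : Matrix δ μ F × Matrix δ μ F} :
    x ∈ radical μ M ↔ M * x.1 = 0 ∧ M * x.2 = 0 := Iff.rfl

lemma card_mul_eq_zero [Fintype F] (M : Matrix δ δ F) :
    Nat.card {A : Matrix δ μ F // M * A = 0} =
      Fintype.card F ^ (Fintype.card μ * (Fintype.card δ - M.rank)) := by
  let e : {A : Matrix δ μ F // M * A = 0} ≃ (μ → LinearMap.ker M.mulVecLin) :=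
    { toFun := fun A j => ⟨A.1.col j, by
        rw [LinearMap.mem_ker, mulVecLin_apply]
        ext i
        exact congrFun (congrFun A.2 i) j⟩
      invFun := fun f => ⟨of fun i j => (f j).1 i, by
        ext i j
        exact congrFun (LinearMap.mem_ker.1 (f j).2) i⟩
      left_inv := fun _ => rfl
      right_inv := fun _ => rfl }
  have hker : Nat.card (LinearMap.ker M.mulVecLin) =
      Fintype.card F ^ (Fintype.card δ - M.rank) := by
    rw [Module.natCard_eq_pow_finrank (K := F), Nat.card_eq_fintype_card]
    congr 1
    have := M.mulVecLin.finrank_range_add_finrank_ker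
    rw [finrank_fintype_fun_eq_card] at this
    rw [Matrix.rank]
    omega
  rw [Nat.card_congr e, Nat.card_fun, hker, Nat.card_eq_fintype_card, ← pow_mul, mul_comm]

lemma card_radical [Fintype F] (M : Matrix δ δ F) :
    Nat.card (radical μ M) =
      Fintype.card F ^ (2 * Fintype.card μ * (Fintype.card δ - M.rank)) := by
  let e : radical μ M ≃ {A : Matrix δ μ F // M * A = 0} × {A : Matrix δ μ F // M * A = 0} :=
    { toFun := fun x => (⟨x.1.1, x.2.1⟩, ⟨x.1.2, x.2.2⟩)
      invFun := fun y => ⟨(y.1.1, y.2.1), y.1.2, y.2.2⟩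
      left_inv := fun _ => rfl
      right_inv := fun _ => rfl }
  rw [Nat.card_congr e, Nat.card_prod, card_mul_eq_zero, ← pow_add]
  congr 1
  ring

lemma AddChar.IsPrimitive.exists_apply_mul_ne_one {ψ : AddChar F ℂ} (hψ : ψ.IsPrimitive) {x : F}
    (hx : x ≠ 0) : ∃ t, ψ (x * t) ≠ 1 := by
  by_contra! h
  exact hψ hx (by ext t; simpa using h t)

lemma exists_isPrimitive_addChar [Fintype F] : ∃ ψ : AddChar F ℂ, ψ.IsPrimitive := by
  have : Nontrivial (AddChar F ℂ) := by
    rw [← Fintype.one_lt_card_iff_nontrivial, AddChar.card_eq]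
    exact Fintype.one_lt_card
  obtain ⟨ψ, hψ⟩ := exists_ne (1 : AddChar F ℂ)
  exact ⟨ψ, AddChar.IsPrimitive.of_ne_one hψ⟩

/-- The character `S ↦ ψ (tr (M S))` of the group of symmetric matrices. -/
def traceChar (ψ : AddChar F ℂ) (M : Matrix δ δ F) : AddChar (symmetricMatrices F δ) ℂ where
  toFun S := ψ (trace (M * S.1))
  map_zero_eq_one' := by simp
  map_add_eq_mul' S T := by simp [mul_add, AddChar.map_add_eq_mul]

lemma traceChar_injOn {ψ : AddChar F ℂ} (hψ : ψ.IsPrimitive) (h2 : (2 : F) ≠ 0)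
    {M N : Matrix δ δ F} (hM : Mᵀ = M) (hN : Nᵀ = N) (h : traceChar ψ M = traceChar ψ N) :
    M = N := by
  classical
  by_contra hne
  obtain ⟨i, j, hij⟩ : ∃ i j, M i j - N i j ≠ 0 := by
    by_contra! hc
    exact hne (by ext i j; exact sub_eq_zero.1 (hc i j))
  obtain ⟨t, ht⟩ := hψ.exists_apply_mul_ne_one (mul_ne_zero h2 hij)
  have hS : (single i j t + single j i t : Matrix δ δ F) ∈ symmetricMatrices F δ := by
    rw [mem_symmetricMatrices]
    simp [add_comm]
  have := DFunLike.congr_fun h ⟨_, hS⟩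
  change ψ _ = ψ _ at this
  apply ht
  have hMji : M j i = M i j := congrFun (congrFun hM i) j
  have hNji : N j i = N i j := congrFun (congrFun hN i) j
  have key : 2 * (M i j - N i j) * t =
      trace (M * (single i j t + single j i t)) - trace (N * (single i j t + single j i t)) := by
    simp only [mul_add, trace_add, trace_mul_single, hMji, hNji]
    simp
    ring
  rw [key, AddChar.map_sub_eq_div, this, div_self]
  exact (ψ.val_isUnit _).ne_zero

lemma exists_traceChar_eq [Fintype F] {ψ : AddChar F ℂ} (hψ : ψ.IsPrimitive) (h2 : (2 : F) ≠ 0)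
    (θ : AddChar (symmetricMatrices F δ) ℂ) : ∃ M, Mᵀ = M ∧ traceChar ψ M = θ := by
  classical
  have : Fintype (symmetricMatrices F δ) := Fintype.ofFinite _
  have hinj : Function.Injective fun M : symmetricMatrices F δ => traceChar ψ M.1 :=
    fun M N h => Subtype.ext (traceChar_injOn hψ h2 M.2 N.2 h)
  obtain ⟨M, hM⟩ := ((Fintype.bijective_iff_injective_and_card _).2
    ⟨hinj, AddChar.card_eq.symm⟩).2 θ
  exact ⟨M.1, M.2, hM⟩

lemma trace_mul_mul_transpose_comm {M : Matrix δ δ F} (hM : Mᵀ = M) (A B : Matrix δ μ F) :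
    trace (M * (B * Aᵀ)) = trace (M * (A * Bᵀ)) := by
  rw [← trace_transpose]
  simp only [transpose_mul, transpose_transpose, hM]
  rw [trace_mul_comm]

end SymmetricMatrices

/-- Coordinates identifying `G` with the two-step nilpotent group of triples `(A, B, S)`, where `S`
is symmetric and
`(A, B, S) (A', B', S') = (A + A', B + B', S + S' + A B'ᵀ + B' Aᵀ)`. -/
structure HeisenbergCoords (F δ μ G : Type) [Field F] [Fintype δ] [Fintype μ] [Group G] where
  /-- The first rectangular coordinate. -/
  a : G → Matrix δ μ F
  /-- The second rectangular coordinate. -/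
  b : G → Matrix δ μ F
  /-- The symmetric coordinate. -/
  s : G → Matrix δ δ F
  a_mul : ∀ g h, a (g * h) = a g + a h
  b_mul : ∀ g h, b (g * h) = b g + b h
  s_mul : ∀ g h, s (g * h) = s g + s h + (a g * (b h)ᵀ + b h * (a g)ᵀ)
  s_symm : ∀ g, (s g)ᵀ = s g
  coords_ext : ∀ g h, a g = a h → b g = b h → s g = s h → g = h
  /-- The element with given coordinates. -/
  elt : Matrix δ μ F → Matrix δ μ F → symmetricMatrices F δ → G
  a_elt : ∀ A B S, a (elt A B S) = A
  b_elt : ∀ A B S, b (elt A B S) = B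
  s_elt : ∀ A B S, s (elt A B S) = S

namespace HeisenbergCoords

open CategoryTheory Module

attribute [simp] a_mul b_mul a_elt b_elt s_elt

variable {F δ μ G : Type} [Field F] [Fintype δ] [Fintype μ] [Group G]
  (c : HeisenbergCoords F δ μ G)

@[simp] lemma a_one : c.a 1 = 0 := by simpa using c.a_mul 1 1

@[simp] lemma b_one : c.b 1 = 0 := by simpa using c.b_mul 1 1

@[simp] lemma s_one : c.s 1 = 0 := by simpa using c.s_mul 1 1

@[simp] lemma a_inv (g : G) : c.a g⁻¹ = -c.a g :=
  eq_neg_of_add_eq_zero_left (by rw [← c.a_mul, inv_mul_cancel, a_one])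

@[simp] lemma b_inv (g : G) : c.b g⁻¹ = -c.b g :=
  eq_neg_of_add_eq_zero_left (by rw [← c.b_mul, inv_mul_cancel, b_one])

/-- The underlying set of `G`. -/
def equiv : G ≃ (Matrix δ μ F × Matrix δ μ F) × symmetricMatrices F δ where
  toFun g := ((c.a g, c.b g), ⟨c.s g, c.s_symm g⟩)
  invFun x := c.elt x.1.1 x.1.2 x.2
  left_inv g := c.coords_ext _ _ (by simp) (by simp) (by simp)
  right_inv x := by simp

/-- The preimage in `G` of the radical of the form attached to `M`. -/
def kernel (M : Matrix δ δ F) : Subgroup G where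
  carrier := {g | (c.a g, c.b g) ∈ radical μ M}
  mul_mem' := fun {g h} hg hh => by
    have := (radical μ M).add_mem hg hh
    simpa using this
  one_mem' := by
    change (c.a 1, c.b 1) ∈ radical μ M
    simp [mem_radical]
  inv_mem' := fun {g} hg => by
    have := (radical μ M).neg_mem hg
    simpa using this

lemma mem_kernel {M : Matrix δ δ F} {g : G} :
    g ∈ c.kernel M ↔ (c.a g, c.b g) ∈ radical μ M := Iff.rfl

instance (M : Matrix δ δ F) : (c.kernel M).Normal where
  conj_mem g hg h := by simpa [mem_kernel] using hg

lemma card_kernel (M : Matrix δ δ F) :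
    Nat.card (c.kernel M) = Nat.card (radical μ M) * Nat.card (symmetricMatrices F δ) := by
  rw [← Nat.card_prod]
  exact Nat.card_congr
    { toFun := fun g => (⟨(c.a g, c.b g), g.2⟩, ⟨c.s g, c.s_symm g⟩)
      invFun := fun x => ⟨c.elt x.1.1.1 x.1.1.2 x.2, by simp [mem_kernel]⟩
      left_inv := fun g => Subtype.ext (c.equiv.left_inv g.1)
      right_inv := fun x => by simp }

/-- The central element with symmetric coordinate `S`. -/
def central (S : symmetricMatrices F δ) : G := c.elt 0 0 S

lemma central_mul_central (S T : symmetricMatrices F δ) :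
    c.central S * c.central T = c.central (S + T) := by
  apply c.coords_ext <;> simp [central, s_mul]

lemma central_zero : c.central 0 = 1 := by
  apply c.coords_ext <;> simp [central]

lemma central_comm (S : symmetricMatrices F δ) (g : G) : c.central S * g = g * c.central S := by
  apply c.coords_ext <;> simp [central, s_mul, add_comm]

lemma central_mem_kernel (M : Matrix δ δ F) (S : symmetricMatrices F δ) :
    c.central S ∈ c.kernel M := by
  simp [mem_kernel, central, mem_radical]

/-- The symmetric coordinate of the commutator of `h` and `g`. -/
def comm (h g : G) : symmetricMatrices F δ :=
  ⟨(c.a h * (c.b g)ᵀ + c.b g * (c.a h)ᵀ) - (c.a g * (c.b h)ᵀ + c.b h * (c.a g)ᵀ), by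
    rw [mem_symmetricMatrices]
    simp only [transpose_sub, transpose_add, transpose_mul, transpose_transpose]
    abel⟩

lemma mul_eq_central_mul (h g : G) : h * g = c.central (c.comm h g) * (g * h) := by
  apply c.coords_ext
  · simp [central, add_comm]
  · simp [central, add_comm]
  · simp only [central, s_mul, a_elt, s_elt, comm, transpose_zero]
    simp
    abel

lemma trace_mul_comm {M : Matrix δ δ F} (hM : Mᵀ = M) (h g : G) :
    trace (M * (c.comm h g).1) =
      2 * trace (c.a h * (M * c.b g)ᵀ) - 2 * trace (M * c.a g * (c.b h)ᵀ) := by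
  have h1 : trace (c.a h * (M * c.b g)ᵀ) = trace (M * (c.a h * (c.b g)ᵀ)) := by
    rw [transpose_mul, hM, ← Matrix.mul_assoc, Matrix.trace_mul_comm]
  rw [h1, Matrix.mul_assoc]
  simp only [comm, Matrix.mul_sub, Matrix.mul_add, trace_sub, trace_add,
    trace_mul_mul_transpose_comm hM (c.a h), trace_mul_mul_transpose_comm hM (c.a g)]
  ring

lemma trace_mul_comm_eq_zero {M : Matrix δ δ F} (hM : Mᵀ = M) (h : G) {g : G}
    (hg : g ∈ c.kernel M) : trace (M * (c.comm h g).1) = 0 := by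
  rw [c.trace_mul_comm hM, hg.1, hg.2]
  simp

lemma exists_trace_mul_comm_ne_one {ψ : AddChar F ℂ} (hψ : ψ.IsPrimitive) (h2 : (2 : F) ≠ 0)
    {M : Matrix δ δ F} (hM : Mᵀ = M) {g : G} (hg : g ∉ c.kernel M) :
    ∃ h, ψ (trace (M * (c.comm h g).1)) ≠ 1 := by
  classical
  have hor : M * c.a g ≠ 0 ∨ M * c.b g ≠ 0 := by
    by_contra! hc
    exact hg hc
  have hne : ∀ X : Matrix δ μ F, X ≠ 0 → ∃ i j, X i j ≠ 0 := fun X hX => by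
    by_contra! hc
    exact hX (by ext i j; exact hc i j)
  rcases hor with hX | hX
  · obtain ⟨i, j, hij⟩ := hne _ hX
    obtain ⟨t, ht⟩ := hψ.exists_apply_mul_ne_one (mul_ne_zero (neg_ne_zero.2 h2) hij)
    refine ⟨c.elt 0 (single i j t) 0, ?_⟩
    rw [c.trace_mul_comm hM]
    convert! ht using 2
    simp [trace_mul_single]
    ring
  · obtain ⟨i, j, hij⟩ := hne _ hX
    obtain ⟨t, ht⟩ := hψ.exists_apply_mul_ne_one (mul_ne_zero h2 hij)
    refine ⟨c.elt (single i j t) 0 0, ?_⟩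
    rw [c.trace_mul_comm hM, Matrix.trace_mul_comm]
    convert! ht using 2
    simp [trace_mul_single, -transpose_mul]
    ring

open Classical in
/-- The linear character of `c.kernel M` extending `S ↦ ψ (tr (M S))` and attached to a character
`θ` of the radical, extended by zero to `G`. -/
noncomputable def kernelChar (ψ : AddChar F ℂ) (M : Matrix δ δ F) (θ : AddChar (radical μ M) ℂ)
    (g : G) : ℂ :=
  if h : g ∈ c.kernel M then ψ (trace (M * c.s g)) * θ ⟨(c.a g, c.b g), h⟩ else 0

section KernelChar

variable {ψ : AddChar F ℂ} {M : Matrix δ δ F} (θ : AddChar (radical μ M) ℂ)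

lemma kernelChar_of_mem {g : G} (h : g ∈ c.kernel M) :
    c.kernelChar ψ M θ g = ψ (trace (M * c.s g)) * θ ⟨(c.a g, c.b g), h⟩ := dif_pos h

lemma kernelChar_of_notMem {g : G} (h : g ∉ c.kernel M) : c.kernelChar ψ M θ g = 0 := dif_neg h

lemma kernelChar_central (S : symmetricMatrices F δ) :
    c.kernelChar ψ M θ (c.central S) = ψ (trace (M * S.1)) := by
  rw [c.kernelChar_of_mem θ (c.central_mem_kernel M S)]
  have h0 : (⟨(c.a (c.central S), c.b (c.central S)), c.central_mem_kernel M S⟩ : radical μ M) =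
      0 := Subtype.ext (by simp [central])
  rw [h0, AddChar.map_zero_eq_one, mul_one]
  simp [central]

lemma kernelChar_one : c.kernelChar ψ M θ 1 = 1 := by
  simpa [central_zero] using c.kernelChar_central (ψ := ψ) θ 0

lemma trace_mul_s_mul (hM : Mᵀ = M) {x : G} (hx : x ∈ c.kernel M) (y : G) :
    trace (M * c.s (x * y)) = trace (M * c.s x) + trace (M * c.s y) := by
  have h : trace (M * (c.a x * (c.b y)ᵀ)) = 0 := by
    rw [← Matrix.mul_assoc, hx.1, Matrix.zero_mul, trace_zero]
  simp [s_mul, Matrix.mul_add, trace_mul_mul_transpose_comm hM (c.a x), h]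

lemma kernelChar_mul (hM : Mᵀ = M) {x y : G} (hx : x ∈ c.kernel M) (hy : y ∈ c.kernel M) :
    c.kernelChar ψ M θ (x * y) = c.kernelChar ψ M θ x * c.kernelChar ψ M θ y := by
  rw [c.kernelChar_of_mem θ hx, c.kernelChar_of_mem θ hy, c.kernelChar_of_mem θ (mul_mem hx hy),
    c.trace_mul_s_mul hM hx, AddChar.map_add_eq_mul]
  have h : (⟨(c.a (x * y), c.b (x * y)), mul_mem hx hy⟩ : radical μ M) =
      ⟨(c.a x, c.b x), hx⟩ + ⟨(c.a y, c.b y), hy⟩ := Subtype.ext (by simp)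
  rw [h, AddChar.map_add_eq_mul]
  ring

lemma kernelChar_conj (hM : Mᵀ = M) {x : G} (hx : x ∈ c.kernel M) (g : G) :
    c.kernelChar ψ M θ (g * x * g⁻¹) = c.kernelChar ψ M θ x := by
  have h : g * x * g⁻¹ = c.central (c.comm g x) * x := by
    rw [c.mul_eq_central_mul g x]; group
  rw [h, c.kernelChar_mul θ hM (c.central_mem_kernel M _) hx, c.kernelChar_central,
    c.trace_mul_comm_eq_zero hM g hx, AddChar.map_zero_eq_one, one_mul]

lemma kernelChar_injective {θ' : AddChar (radical μ M) ℂ}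
    (h : c.kernelChar ψ M θ = c.kernelChar ψ M θ') : θ = θ' := by
  ext x
  have hx : c.elt x.1.1 x.1.2 0 ∈ c.kernel M := by simp [mem_kernel]
  have := congrFun h (c.elt x.1.1 x.1.2 0)
  rw [c.kernelChar_of_mem θ hx, c.kernelChar_of_mem θ' hx] at this
  simpa using this

end KernelChar

section Characters

variable [Fintype F] {ψ : AddChar F ℂ}

lemma finite (c : HeisenbergCoords F δ μ G) : Finite G := Finite.of_equiv _ c.equiv.symm

/-- The value at `g` of the irreducible character attached to `M` and `θ`. -/
noncomputable def irrChar (ψ : AddChar F ℂ) (M : Matrix δ δ F) (θ : AddChar (radical μ M) ℂ)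
    (g : G) : ℂ :=
  (Fintype.card F : ℂ) ^ (Fintype.card μ * M.rank) * c.kernelChar ψ M θ g

lemma irrChar_one (M : Matrix δ δ F) (θ : AddChar (radical μ M) ℂ) :
    c.irrChar ψ M θ 1 = (Fintype.card F : ℂ) ^ (Fintype.card μ * M.rank) := by
  rw [irrChar, kernelChar_one, mul_one]

lemma character_eq_irrChar (hψ : ψ.IsPrimitive) (h2 : (2 : F) ≠ 0) {M : Matrix δ δ F}
    (hM : Mᵀ = M) (θ : AddChar (radical μ M) ℂ) (V : FDRep ℂ G) [Simple V]
    (hV : ∀ x ∈ c.kernel M, V.ρ x = c.kernelChar ψ M θ x • (1 : V →ₗ[ℂ] V)) :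
    V.character = c.irrChar ψ M θ := by
  have := c.finite
  have hvan : ∀ g ∉ c.kernel M, V.character g = 0 := fun g hg => by
    obtain ⟨h, hh⟩ := c.exists_trace_mul_comm_ne_one hψ h2 hM hg
    exact V.character_eq_zero_of_conj _ _ hV (c.central_mem_kernel M _)
      (by rwa [c.kernelChar_central]) (c.mul_eq_central_mul h g)
  have hcard := V.finrank_sq_mul_card _ _ hV hvan
  have hrank : M.rank ≤ Fintype.card δ := M.rank_le_card_width
  have hdim : finrank ℂ V = Fintype.card F ^ (Fintype.card μ * M.rank) := by
    have hX : Nat.card (Matrix δ μ F) = Fintype.card F ^ (Fintype.card μ * Fintype.card δ) := by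
      rw [Module.natCard_eq_pow_finrank (K := F), Nat.card_eq_fintype_card,
        Module.finrank_matrix, finrank_self, mul_one, mul_comm]
    rw [c.card_kernel, card_radical, Nat.card_congr c.equiv, Nat.card_prod, Nat.card_prod, hX,
      ← mul_assoc] at hcard
    have hcard := Nat.eq_of_mul_eq_mul_right Nat.card_pos hcard
    have hpos : 0 < Fintype.card F ^ (2 * Fintype.card μ * (Fintype.card δ - M.rank)) :=
      pow_pos Fintype.card_pos _
    refine Nat.pow_left_injective two_ne_zero (Nat.eq_of_mul_eq_mul_right hpos (hcard.trans ?_))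
    obtain ⟨e, he⟩ := Nat.exists_eq_add_of_le hrank
    rw [he, Nat.add_sub_cancel_left]
    ring
  funext g
  by_cases hg : g ∈ c.kernel M
  · simp [FDRep.character, hV g hg, irrChar, hdim, mul_comm]
  · rw [hvan g hg, irrChar, c.kernelChar_of_notMem θ hg, mul_zero]

lemma exists_simple_character_eq (hψ : ψ.IsPrimitive) (h2 : (2 : F) ≠ 0) {M : Matrix δ δ F}
    (hM : Mᵀ = M) (θ : AddChar (radical μ M) ℂ) :
    ∃ V : FDRep ℂ G, Simple V ∧ V.character = c.irrChar ψ M θ := by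
  have := c.finite
  obtain ⟨V, hV, hVρ⟩ := FDRep.exists_simple_of_conj_invariant (c.kernel M) (c.kernelChar ψ M θ)
    (c.kernelChar_one θ) (fun x hx y hy => c.kernelChar_mul θ hM hx hy)
    (fun x hx g => c.kernelChar_conj θ hM hx g)
  exact ⟨V, hV, c.character_eq_irrChar hψ h2 hM θ V hVρ⟩

lemma exists_character_eq_irrChar (hψ : ψ.IsPrimitive) (h2 : (2 : F) ≠ 0) (V : FDRep ℂ G)
    [Simple V] : ∃ (M : Matrix δ δ F) (θ : AddChar (radical μ M) ℂ),
      Mᵀ = M ∧ V.character = c.irrChar ψ M θ := by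
  have hnt : Nontrivial V := by
    by_contra hV
    rw [not_nontrivial_iff_subsingleton] at hV
    exact id_nonzero V (by ext v; exact Subsingleton.elim _ _)
  have hscal : ∀ {x y : ℂ}, x • (1 : V →ₗ[ℂ] V) = y • (1 : V →ₗ[ℂ] V) → x = y :=
    fun h => smul_left_injective ℂ (one_ne_zero) h
  have hcomm : ∀ x : G, (∀ g, V.ρ (g * x) = V.ρ (x * g)) → ∃ z : ℂ, V.ρ x = z • (1 : V →ₗ[ℂ] V) :=
    fun x hx => V.exists_eq_smul_one_of_commute (V.ρ x) fun g => by
      rw [← Module.End.mul_eq_comp, ← Module.End.mul_eq_comp, ← map_mul, ← map_mul, hx]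
  choose ζ hζ using fun S => hcomm (c.central S) fun g => by rw [c.central_comm]
  let ζ' : AddChar (symmetricMatrices F δ) ℂ :=
    { toFun := ζ
      map_zero_eq_one' := hscal (by rw [← hζ, c.central_zero, map_one, one_smul])
      map_add_eq_mul' := fun S T => hscal (by
        rw [← hζ, ← c.central_mul_central, map_mul, hζ, hζ, smul_mul_smul_comm, mul_one]) }
  obtain ⟨M, hM, hMζ⟩ := exists_traceChar_eq hψ h2 ζ'
  have hcen : ∀ S, V.ρ (c.central S) = ψ (trace (M * S.1)) • (1 : V →ₗ[ℂ] V) := fun S => by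
    rw [hζ]
    exact congrArg (· • (1 : V →ₗ[ℂ] V)) (DFunLike.congr_fun hMζ S).symm
  have hker : ∀ x ∈ c.kernel M, ∃ z : ℂ, V.ρ x = z • (1 : V →ₗ[ℂ] V) := fun x hx =>
    hcomm x fun g => by
      rw [c.mul_eq_central_mul g x, map_mul, hcen, c.trace_mul_comm_eq_zero hM g hx,
        AddChar.map_zero_eq_one, one_smul, one_mul]
  have hmem : ∀ x : radical μ M, c.elt x.1.1 x.1.2 0 ∈ c.kernel M := fun x => by
    simp [mem_kernel]
  choose η hη using fun x : radical μ M => hker _ (hmem x)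
  have hsplit : ∀ x : G, x = c.central ⟨c.s x, c.s_symm x⟩ * c.elt (c.a x) (c.b x) 0 := fun x => by
    apply c.coords_ext <;> simp [central, s_mul]
  have hsplitρ : ∀ x : G, V.ρ x = ψ (trace (M * c.s x)) • V.ρ (c.elt (c.a x) (c.b x) 0) :=
    fun x => by
      conv_lhs => rw [hsplit x]
      rw [map_mul, hcen, smul_mul_assoc, one_mul]
  let θ : AddChar (radical μ M) ℂ :=
    { toFun := η
      map_zero_eq_one' := hscal (by
        rw [← hη, one_smul]
        exact (congrArg V.ρ c.central_zero).trans (map_one _))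
      map_add_eq_mul' := fun x y => hscal (by
        have h := hsplitρ (c.elt x.1.1 x.1.2 0 * c.elt y.1.1 y.1.2 0)
        rw [c.trace_mul_s_mul hM (hmem x)] at h
        simp only [s_elt, a_mul, b_mul, a_elt, b_elt, map_mul, hη, ZeroMemClass.coe_zero,
          Matrix.mul_zero, trace_zero, add_zero, AddChar.map_zero_eq_one, one_smul,
          smul_mul_smul_comm, mul_one] at h
        rw [h, ← hη]
        rfl) }
  refine ⟨M, θ, hM, c.character_eq_irrChar hψ h2 hM θ V fun x hx => ?_⟩
  rw [hsplitρ x, c.kernelChar_of_mem θ hx, mul_smul]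
  exact congrArg _ (hη ⟨(c.a x, c.b x), hx⟩)

lemma irrChar_injective (hψ : ψ.IsPrimitive) (h2 : (2 : F) ≠ 0) {M N : Matrix δ δ F}
    (hM : Mᵀ = M) (hN : Nᵀ = N) {θ : AddChar (radical μ M) ℂ} {η : AddChar (radical μ N) ℂ}
    (h : c.irrChar ψ M θ = c.irrChar ψ N η) : M = N ∧ HEq θ η := by
  have h1 := congrFun h 1
  rw [irrChar_one, irrChar_one] at h1
  have hne : (Fintype.card F : ℂ) ≠ 0 := Nat.cast_ne_zero.2 Fintype.card_ne_zero
  have hk : c.kernelChar ψ M θ = c.kernelChar ψ N η := by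
    funext g
    have := congrFun h g
    rw [irrChar, irrChar, h1] at this
    exact mul_left_cancel₀ (pow_ne_zero _ hne) this
  have hMN : M = N := traceChar_injOn hψ h2 hM hN (by
    ext S
    have := congrFun hk (c.central S)
    rwa [kernelChar_central, kernelChar_central] at this)
  subst hMN
  exact ⟨rfl, heq_of_eq (c.kernelChar_injective θ hk)⟩

theorem card_irreducible_characters (c : HeisenbergCoords F δ μ G) (h2 : (2 : F) ≠ 0)
    (hμ : 0 < Fintype.card μ) (r : ℕ) :
    Nat.card {χ : G → ℂ | (∃ V : FDRep ℂ G, Simple V ∧ V.character = χ) ∧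
        χ 1 = (Fintype.card F : ℂ) ^ (Fintype.card μ * r)} =
      Fintype.card F ^ (2 * Fintype.card μ * (Fintype.card δ - r)) *
        Nat.card {M : Matrix δ δ F | Mᵀ = M ∧ M.rank = r} := by
  classical
  obtain ⟨ψ, hψ⟩ := exists_isPrimitive_addChar (F := F)
  have hbij : Function.Bijective
      (fun x : (Σ M : {M : Matrix δ δ F | Mᵀ = M ∧ M.rank = r}, AddChar (radical μ M.1) ℂ) =>
        (⟨c.irrChar ψ x.1.1 x.2, c.exists_simple_character_eq hψ h2 x.1.2.1 x.2, by
          rw [irrChar_one, x.1.2.2]⟩ :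
        {χ : G → ℂ | (∃ V : FDRep ℂ G, Simple V ∧ V.character = χ) ∧
          χ 1 = (Fintype.card F : ℂ) ^ (Fintype.card μ * r)})) := by
    refine ⟨?_, ?_⟩
    · rintro ⟨⟨M, hM⟩, θ⟩ ⟨⟨N, hN⟩, η⟩ h
      obtain ⟨rfl, hθ⟩ := c.irrChar_injective hψ h2 hM.1 hN.1 (congrArg Subtype.val h)
      exact Sigma.ext rfl hθ
    · rintro ⟨χ, ⟨V, hV, rfl⟩, hχ⟩
      obtain ⟨M, θ, hM, hMθ⟩ := c.exists_character_eq_irrChar hψ h2 V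
      rw [hMθ, irrChar_one] at hχ
      have hpow := Nat.pow_right_injective (Nat.succ_le_of_lt (Fintype.one_lt_card (α := F)))
        (by exact_mod_cast hχ : Fintype.card F ^ _ = Fintype.card F ^ _)
      exact ⟨⟨⟨M, hM, Nat.eq_of_mul_eq_mul_left hμ hpow⟩, θ⟩, Subtype.ext hMθ.symm⟩
  rw [← Nat.card_congr (Equiv.ofBijective _ hbij), Nat.card_sigma]
  have hθ : ∀ M : {M : Matrix δ δ F | Mᵀ = M ∧ M.rank = r},
      Nat.card (AddChar (radical μ M.1) ℂ) =
        Fintype.card F ^ (2 * Fintype.card μ * (Fintype.card δ - r)) := fun M => by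
    have := Fintype.ofFinite (radical μ M.1)
    rw [Nat.card_eq_fintype_card, AddChar.card_eq, ← Nat.card_eq_fintype_card, card_radical,
      M.2.2]
  rw [Finset.sum_congr rfl fun M _ => hθ M, Finset.sum_const, Finset.card_univ,
    ← Nat.card_eq_fintype_card, smul_eq_mul, mul_comm]

theorem exists_character_one_eq (c : HeisenbergCoords F δ μ G) (h2 : (2 : F) ≠ 0) (V : FDRep ℂ G)
    [Simple V] :
    ∃ r ≤ Fintype.card δ, V.character 1 = (Fintype.card F : ℂ) ^ (Fintype.card μ * r) := by
  obtain ⟨ψ, hψ⟩ := exists_isPrimitive_addChar (F := F)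
  obtain ⟨M, θ, -, hMθ⟩ := c.exists_character_eq_irrChar hψ h2 V
  exact ⟨M.rank, M.rank_le_card_width, by rw [hMθ, irrChar_one]⟩

end Characters

end HeisenbergCoords

namespace SpUnipotentRadical

section Coordinates

variable {F : Type} [Field F] {n d : ℕ}

/-- The element of `RuC` with parameters `A` and `V = [[S, B], [Bᵀ, 0]]`, multiplied out. -/
def ruMat (A B : Matrix (Fin d) (Fin (n - d)) F) (S : Matrix (Fin d) (Fin d) F) :
    Matrix (κ n d) (κ n d) F :=
  fromBlocks (fromBlocks 1 A 0 1) (fromBlocks (S - B * Aᵀ) B Bᵀ 0) 0 (fromBlocks 1 0 (-Aᵀ) 1)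

lemma Umat_transpose_inv (A : Matrix (Fin d) (Fin (n - d)) F) :
    ((Umat F n d A)ᵀ)⁻¹ = fromBlocks 1 0 (-Aᵀ) 1 := by
  apply Matrix.inv_eq_right_inv
  simp [Umat, fromBlocks_transpose, fromBlocks_multiply]

lemma mem_RuC_iff {g : Matrix (κ n d) (κ n d) F} :
    g ∈ RuC F n d ↔ ∃ A B S, Sᵀ = S ∧ g = ruMat A B S := by
  constructor
  · rintro ⟨A, V, ⟨hV, hV0⟩, rfl⟩
    have h22 : V.toBlocks₂₂ = 0 := by ext i j; exact hV0 i j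
    have h21 : V.toBlocks₂₁ = V.toBlocks₁₂ᵀ := by
      ext i j; exact congrFun (congrFun hV.symm _) _
    have h11 : V.toBlocks₁₁ᵀ = V.toBlocks₁₁ := by
      ext i j; exact congrFun (congrFun hV _) _
    refine ⟨A, V.toBlocks₁₂, V.toBlocks₁₁, h11, ?_⟩
    rw [Umat_transpose_inv, Umat, ruMat]
    congr 1
    conv_lhs => rw [← fromBlocks_toBlocks V, h22, h21]
    simp [fromBlocks_multiply, sub_eq_add_neg]
  · rintro ⟨A, B, S, hS, rfl⟩
    refine ⟨A, fromBlocks S B Bᵀ 0, ⟨?_, fun i j => rfl⟩, ?_⟩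
    · simp [fromBlocks_transpose, hS]
    · rw [Umat_transpose_inv, Umat, ruMat]
      simp [fromBlocks_multiply, sub_eq_add_neg]

lemma ruMat_mul (A B A' B' : Matrix (Fin d) (Fin (n - d)) F) (S S' : Matrix (Fin d) (Fin d) F) :
    ruMat A B S * ruMat A' B' S' =
      ruMat (A + A') (B + B') (S + S' + (A * B'ᵀ + B' * Aᵀ)) := by
  have h : S' - B' * A'ᵀ + A * B'ᵀ + (S - B * Aᵀ + -(B * A'ᵀ)) =
      S + S' + (A * B'ᵀ + B' * Aᵀ) - (B * Aᵀ + B' * Aᵀ + (B * A'ᵀ + B' * A'ᵀ)) := by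
    abel
  simp [ruMat, fromBlocks_multiply, fromBlocks_add, Matrix.mul_add, Matrix.add_mul, h, add_comm]

lemma ruMat_zero : ruMat (0 : Matrix (Fin d) (Fin (n - d)) F) 0 0 = 1 := by
  simp [ruMat]

/-- `ruMat` as a unit. -/
def ruUnit (A B : Matrix (Fin d) (Fin (n - d)) F) (S : Matrix (Fin d) (Fin d) F) :
    (Matrix (κ n d) (κ n d) F)ˣ where
  val := ruMat A B S
  inv := ruMat (-A) (-B) (-S + (A * Bᵀ + B * Aᵀ))
  val_inv := by
    rw [ruMat_mul, ← ruMat_zero]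
    congr 1
    · abel
    · abel
    · simp only [transpose_neg, Matrix.mul_neg, Matrix.neg_mul]; abel
  inv_val := by
    rw [ruMat_mul, ← ruMat_zero]
    congr 1
    · abel
    · abel
    · simp only [transpose_neg, Matrix.mul_neg, Matrix.neg_mul]; abel

/-- The coordinates `(A, B, S)` on the unipotent radical. -/
def coords (G : Subgroup (Matrix (κ n d) (κ n d) F)ˣ)
    (hG : ∀ u : (Matrix (κ n d) (κ n d) F)ˣ,
      u ∈ G ↔ (u : Matrix (κ n d) (κ n d) F) ∈ RuC F n d) :
    HeisenbergCoords F (Fin d) (Fin (n - d)) G :=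
  have hex : ∀ g : G, ∃ A B S, Sᵀ = S ∧ (g.1 : Matrix (κ n d) (κ n d) F) = ruMat A B S :=
    fun g => mem_RuC_iff.1 ((hG g.1).1 g.2)
  { a := fun g => g.1.1.toBlocks₁₁.toBlocks₁₂
    b := fun g => g.1.1.toBlocks₁₂.toBlocks₁₂
    s := fun g => g.1.1.toBlocks₁₂.toBlocks₁₁ +
      g.1.1.toBlocks₁₂.toBlocks₁₂ * (g.1.1.toBlocks₁₁.toBlocks₁₂)ᵀ
    a_mul := fun g h => by
      obtain ⟨A, B, S, -, hg⟩ := hex g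
      obtain ⟨A', B', S', -, hh⟩ := hex h
      rw [Subgroup.coe_mul, Units.val_mul, hg, hh, ruMat_mul]
      simp [ruMat]
    b_mul := fun g h => by
      obtain ⟨A, B, S, -, hg⟩ := hex g
      obtain ⟨A', B', S', -, hh⟩ := hex h
      rw [Subgroup.coe_mul, Units.val_mul, hg, hh, ruMat_mul]
      simp [ruMat]
    s_mul := fun g h => by
      obtain ⟨A, B, S, -, hg⟩ := hex g
      obtain ⟨A', B', S', -, hh⟩ := hex h
      rw [Subgroup.coe_mul, Units.val_mul, hg, hh, ruMat_mul]
      simp [ruMat]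
    s_symm := fun g => by
      obtain ⟨A, B, S, hS, hg⟩ := hex g
      rw [hg]
      simp [ruMat, hS]
    coords_ext := fun g h ha hb hs => by
      obtain ⟨A, B, S, -, hg⟩ := hex g
      obtain ⟨A', B', S', -, hh⟩ := hex h
      rw [hg, hh] at ha hb hs
      simp only [ruMat, toBlocks_fromBlocks₁₁, toBlocks_fromBlocks₁₂, sub_add_cancel] at ha hb hs
      exact Subtype.ext (Units.ext (by rw [hg, hh, ha, hb, hs]))
    elt := fun A B S => ⟨ruUnit A B S.1, (hG _).2 (mem_RuC_iff.2 ⟨A, B, S.1, S.2, rfl⟩)⟩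
    a_elt := fun A B S => by simp [ruUnit, ruMat]
    b_elt := fun A B S => by simp [ruUnit, ruMat]
    s_elt := fun A B S => by simp [ruUnit, ruMat] }

end Coordinates

/-- the number of irreducible characters of `R_u^{C,d}` of degree
`q^{(n−d)r}` equals `q^{2d(n−d)−2(n−d)r}` times the number of symmetric `d×d` matrices
over `𝔽_q` of rank `r`; moreover every irreducible character of `R_u^{C,d}` has degree
`q^{(n−d)r}` for some `0 ≤ r ≤ d`. -/
theorem ruC_char_count
    (p k q : ℕ) (hp : p.Prime) (hpodd : Odd p) (hk : 1 ≤ k) (hq : q = p ^ k)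
    (F : Type) [Field F] [Fintype F] (hF : Fintype.card F = q)
    (n d : ℕ) (hd : 1 ≤ d) (hdn : d < n)
    (G : Subgroup (Matrix (κ n d) (κ n d) F)ˣ)
    (hG : ∀ u : (Matrix (κ n d) (κ n d) F)ˣ,
      u ∈ G ↔ (u : Matrix (κ n d) (κ n d) F) ∈ RuC F n d)
    (r : ℕ) (hr : r ≤ d) :
    Nat.card {χ : ↥G → ℂ |
        (∃ V : FDRep ℂ ↥G, CategoryTheory.Simple V ∧ FDRep.character V = χ) ∧
        χ 1 = (q : ℂ) ^ ((n - d) * r)} =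
      q ^ (2 * d * (n - d) - 2 * (n - d) * r) *
        Nat.card {M : Matrix (Fin d) (Fin d) F | Mᵀ = M ∧ M.rank = r} ∧
    ∀ V : FDRep ℂ ↥G, CategoryTheory.Simple V →
      ∃ r' : ℕ, r' ≤ d ∧ FDRep.character V 1 = (q : ℂ) ^ ((n - d) * r') := by
  subst hF
  have h2 : (2 : F) ≠ 0 := by
    apply Ring.two_ne_zero
    intro hchar
    have hcard := FiniteField.even_card_iff_char_two.1 hchar
    rw [hq] at hcard
    exact (Nat.not_even_iff_odd.2 (hpodd.pow (n := k))) (Nat.even_iff.2 hcard)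
  have c := coords G hG
  refine ⟨?_, fun V hV => ?_⟩
  · have h := c.card_irreducible_characters h2 (by simpa using hdn) r
    rw [Fintype.card_fin, Fintype.card_fin] at h
    rw [h]
    congr 2
    rw [Nat.mul_sub]
    congr 1
    ring
  · simpa using c.exists_character_one_eq h2 V

end SpUnipotentRadical
end
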